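/- arXiv:1802.03854 — 5 statements merged into one kernel-verified Lean document; each statement's English description precedes it below -/
import Mathlib

section
/- Let r ∈ {3,4,6}, let ξ = e^{2πi/r}, let n ≥ 1, and let Λ = ℤ[ξ]e_1 + Σ_{j=2}^{n} ℤ[ξ](e_{j-1} − e_j) ⊆ ℂⁿ (a G(r,1,n)-invariant ℤ-lattice of full rank 2n). Then the affine reflection group W = G(r,1,n) ⋉ Λ has the Steinberg property: every point of ℂⁿ fixed by some non-identity element of W lies on a reflecting hyperplane of W. -/
open Matrix Complex

noncomputable section

/-- `ℤ[ζ] = ℤ + ℤζ` as a subset of `ℂ`. -/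
def Zlat (ζ : ℂ) : Set ℂ := {z | ∃ a b : ℤ, z = (a : ℂ) + (b : ℂ) * ζ}

/-- Membership in the complex reflection group `G(r,p,n)`: monomial matrices whose
nonzero entries are `r`-th roots of unity and whose product of nonzero entries,
raised to the power `r / p`, equals `1`. -/
def IsGrpn (r p n : ℕ) (M : Matrix (Fin n) (Fin n) ℂ) : Prop :=
  (∀ i, ∃! j, M i j ≠ 0) ∧ (∀ j, ∃! i, M i j ≠ 0) ∧
  (∀ i j, M i j ≠ 0 → M i j ^ r = 1) ∧
  (∏ i, ∑ j, M i j) ^ (r / p) = 1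

/-- The affine transformation `v ↦ M v + t` encoded by the pair `g = (M, t)`. -/
def applyAff {n : ℕ} (g : Matrix (Fin n) (Fin n) ℂ × (Fin n → ℂ)) (v : Fin n → ℂ) :
    Fin n → ℂ :=
  g.1.mulVec v + g.2

/-- An affine hyperplane in `ℂⁿ`: the solution set of a nonzero affine-linear equation. -/
def IsAffineHyperplane {n : ℕ} (H : Set (Fin n → ℂ)) : Prop :=
  ∃ a : Fin n → ℂ, a ≠ 0 ∧ ∃ c : ℂ, H = {v | ∑ i, a i * v i = c}

/-- A reflecting hyperplane of `W`: an affine hyperplane fixed pointwise by some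
non-identity element of `W`. -/
def IsReflectingHyperplane {n : ℕ}
    (W : Matrix (Fin n) (Fin n) ℂ × (Fin n → ℂ) → Prop) (H : Set (Fin n → ℂ)) : Prop :=
  IsAffineHyperplane H ∧
  ∃ g, W g ∧ (∃ v, applyAff g v ≠ v) ∧ ∀ v ∈ H, applyAff g v = v

/-- `W` has the Steinberg property: every point fixed by some non-identity element
of `W` lies on a reflecting hyperplane of `W`. -/
def SteinbergProperty {n : ℕ}
    (W : Matrix (Fin n) (Fin n) ℂ × (Fin n → ℂ) → Prop) : Prop :=
  ∀ u : Fin n → ℂ,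
    (∃ g, W g ∧ (∃ v, applyAff g v ≠ v) ∧ applyAff g u = u) →
    ∃ H, IsReflectingHyperplane W H ∧ u ∈ H

/-- `stdGen n 0 = e₁` and, for `j ≥ 1` (0-indexed), `stdGen n j = e_{j-1} - e_j`. -/
def stdGen (n : ℕ) (j : Fin n) : Fin n → ℂ := fun i =>
  if i = j then (if (j : ℕ) = 0 then 1 else -1)
  else if (i : ℕ) + 1 = (j : ℕ) then 1 else 0

/-- `genB n ξ 0 = ξ e₁ - e₂` and, for `j ≥ 1` (0-indexed), `genB n ξ j = e_{j-1} - e_j`. -/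
def genB (n : ℕ) (ξ : ℂ) (j : Fin n) : Fin n → ℂ :=
  if (j : ℕ) = 0 then
    (fun i => if (i : ℕ) = 0 then ξ else if (i : ℕ) = 1 then -1 else 0)
  else stdGen n j

lemma Zlat.zero (ζ : ℂ) : (0 : ℂ) ∈ Zlat ζ := ⟨0, 0, by simp⟩

lemma Zlat.add {ζ x y : ℂ} (hx : x ∈ Zlat ζ) (hy : y ∈ Zlat ζ) : x + y ∈ Zlat ζ := by
  obtain ⟨a, b, rfl⟩ := hx
  obtain ⟨c, d, rfl⟩ := hy
  exact ⟨a + c, b + d, by push_cast; ring⟩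

lemma Zlat.neg {ζ x : ℂ} (hx : x ∈ Zlat ζ) : -x ∈ Zlat ζ := by
  obtain ⟨a, b, rfl⟩ := hx
  exact ⟨-a, -b, by push_cast; ring⟩

lemma Zlat.sum {ι : Type*} {ζ : ℂ} (s : Finset ι) {f : ι → ℂ} (hf : ∀ i ∈ s, f i ∈ Zlat ζ) :
    ∑ i ∈ s, f i ∈ Zlat ζ :=
  Finset.sum_induction f (· ∈ Zlat ζ) (fun _ _ => Zlat.add) (Zlat.zero ζ) hf

lemma sq_mem_Zlat {r : ℕ} (hr : r = 3 ∨ r = 4 ∨ r = 6) {ξ : ℂ} (h : IsPrimitiveRoot ξ r) :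
    ξ ^ 2 ∈ Zlat ξ := by
  rcases hr with rfl | rfl | rfl
  · have h1 := sub_ne_zero.2 (h.ne_one (by norm_num))
    refine ⟨-1, -1, mul_left_cancel₀ h1 ?_⟩
    push_cast
    linear_combination h.pow_eq_one
  · have h2 := sub_ne_zero.2 (h.pow_ne_one_of_pos_of_lt (l := 2) (by norm_num) (by norm_num))
    refine ⟨-1, 0, mul_left_cancel₀ h2 ?_⟩
    push_cast
    linear_combination h.pow_eq_one
  · have h3 := sub_ne_zero.2 (h.pow_ne_one_of_pos_of_lt (l := 3) (by norm_num) (by norm_num))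
    have h2 := h.pow_ne_one_of_pos_of_lt (l := 2) (by norm_num) (by norm_num)
    have h1 : ξ + 1 ≠ 0 := fun h0 => h2 (by linear_combination (ξ - 1) * h0)
    refine ⟨-1, 1, mul_left_cancel₀ (mul_ne_zero h3 h1) ?_⟩
    push_cast
    linear_combination h.pow_eq_one

lemma Zlat.root_mul {r : ℕ} (hr : r = 3 ∨ r = 4 ∨ r = 6) {ξ m x : ℂ} (h : IsPrimitiveRoot ξ r)
    (hm : m ^ r = 1) (hx : x ∈ Zlat ξ) : m * x ∈ Zlat ξ := by
  have : NeZero r := ⟨by omega⟩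
  obtain ⟨k, -, rfl⟩ := h.eq_pow_of_pow_eq_one hm
  clear hm
  obtain ⟨p, q, hpq⟩ := sq_mem_Zlat hr h
  induction k with
  | zero => simpa using hx
  | succ k ih =>
    obtain ⟨a, b, hab⟩ := ih
    refine ⟨b * p, a + b * q, ?_⟩
    push_cast
    linear_combination ξ * hab + b * hpq

lemma stdGen_mem_Zlat_mul {n : ℕ} {ξ c : ℂ} (hc : c ∈ Zlat ξ) (j i : Fin n) :
    c * stdGen n j i ∈ Zlat ξ := by
  unfold stdGen
  split_ifs
  · simpa using hc
  · simpa using Zlat.neg hc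
  · simpa using hc
  · simpa using Zlat.zero ξ

/-- The lattice spanned over `ℤ[ξ]` by the vectors `stdGen n j` is `ℤ[ξ]ⁿ`. -/
lemma exists_stdGen_combination_iff {n : ℕ} {ξ : ℂ} (v : Fin n → ℂ) :
    (∃ c : Fin n → ℂ, (∀ j, c j ∈ Zlat ξ) ∧ v = ∑ j, c j • stdGen n j) ↔
      ∀ i, v i ∈ Zlat ξ := by
  constructor
  · rintro ⟨c, hc, rfl⟩ i
    rw [Finset.sum_apply]
    exact Zlat.sum _ fun j _ => stdGen_mem_Zlat_mul (hc j) j i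
  · intro hv
    let S : ℕ → ℂ := fun k => ∑ i : Fin n, if k ≤ (i : ℕ) then v i else 0
    have hS : ∀ k, S k ∈ Zlat ξ := fun k => Zlat.sum _ fun i _ => by
      split_ifs
      exacts [hv i, Zlat.zero ξ]
    have hstep : ∀ i : Fin n, S i = v i + S (i + 1) := fun i => by
      have : v i = ∑ k : Fin n, if k = i then v k else 0 := by simp
      rw [this, ← Finset.sum_add_distrib]
      refine Finset.sum_congr rfl fun k _ => ?_
      simp only [Fin.ext_iff]
      split_ifs <;> first | omega | simp
    have htop : S n = 0 := Finset.sum_eq_zero fun i _ => if_neg (by omega)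
    refine ⟨fun j => if (j : ℕ) = 0 then S 0 else -S j, fun j => ?_, ?_⟩
    · dsimp only
      split_ifs
      exacts [hS 0, Zlat.neg (hS j)]
    · ext i
      have hterm : ∀ j : Fin n, (if (j : ℕ) = 0 then S 0 else -S j) * stdGen n j i =
          (if j = i then S j else 0) - (if (i : ℕ) + 1 = j then S j else 0) := fun j => by
        unfold stdGen
        by_cases hj : (j : ℕ) = 0
        · simp only [Fin.ext_iff, hj, if_true]
          split_ifs <;> first | contradiction | omega | simp
        · simp only [Fin.ext_iff, hj, if_false]
          split_ifs <;> first | omega | simp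
      have hnext : (∑ j : Fin n, if (i : ℕ) + 1 = j then S j else 0) = S (i + 1) := by
        by_cases h : (i : ℕ) + 1 < n
        · rw [Finset.sum_eq_single (⟨i + 1, h⟩ : Fin n)]
          · simp
          · intro b _ hb
            exact if_neg fun h' => hb (Fin.ext h'.symm)
          · simp
        · rw [show (i : ℕ) + 1 = n by omega, htop]
          exact Finset.sum_eq_zero fun j _ => if_neg (by omega)
      simp only [Finset.sum_apply, Pi.smul_apply, smul_eq_mul, hterm, Finset.sum_sub_distrib,
        hnext]
      simp [hstep i]

/-- The monomial matrix whose action is `(v a)ₐ ↦ (d a * v (σ a))ₐ`. -/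
def monomialMatrix {n : ℕ} (σ : Equiv.Perm (Fin n)) (d : Fin n → ℂ) :
    Matrix (Fin n) (Fin n) ℂ :=
  Matrix.of fun a b => if b = σ a then d a else 0

lemma monomialMatrix_mulVec {n : ℕ} (σ : Equiv.Perm (Fin n)) (d v : Fin n → ℂ) (a : Fin n) :
    (monomialMatrix σ d).mulVec v a = d a * v (σ a) := by
  simp [monomialMatrix, Matrix.mulVec, dotProduct]

lemma isGrpn_monomialMatrix {r n : ℕ} (hr : r ≠ 0) (σ : Equiv.Perm (Fin n)) {d : Fin n → ℂ}
    (hd : ∀ a, d a ^ r = 1) : IsGrpn r 1 n (monomialMatrix σ d) := by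
  have h0 : ∀ a, d a ≠ 0 := fun a h => by simpa [h, hr] using hd a
  refine ⟨fun i => ⟨σ i, by simp [monomialMatrix, h0], fun j hj => ?_⟩,
    fun j => ⟨σ.symm j, by simp [monomialMatrix, h0], fun i hi => ?_⟩, fun i j h => ?_, ?_⟩
  · by_contra h
    simp [monomialMatrix, h] at hj
  · by_contra h
    have : j ≠ σ i := fun h' => h (by simp [h'])
    simp [monomialMatrix, this] at hi
  · by_cases hj : j = σ i
    · simpa [monomialMatrix, hj] using hd i
    · simp [monomialMatrix, hj] at h
  · simp [monomialMatrix, ← Finset.prod_pow, hd]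

/-- An off-diagonal reflection: the hyperplane `x_i - m x_j = t` is reflecting. -/
lemma isReflectingHyperplane_sub_mul {r n : ℕ} (hr : r = 3 ∨ r = 4 ∨ r = 6) {ξ : ℂ}
    (h : IsPrimitiveRoot ξ r) {i j : Fin n} (hij : i ≠ j) {m t : ℂ} (hm : m ^ r = 1)
    (ht : t ∈ Zlat ξ) :
    IsReflectingHyperplane (fun g => IsGrpn r 1 n g.1 ∧ ∀ k, g.2 k ∈ Zlat ξ)
      {v : Fin n → ℂ | v i - m * v j = t} := by
  have hr0 : r ≠ 0 := by omega
  have hm0 : m ≠ 0 := fun h => by simp [h, hr0] at hm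
  have hm' : m⁻¹ ^ r = 1 := by rw [inv_pow, hm, inv_one]
  let d : Fin n → ℂ := fun a => if a = i then m else if a = j then m⁻¹ else 1
  let s : Fin n → ℂ := fun a => if a = i then t else if a = j then -(m⁻¹ * t) else 0
  refine ⟨⟨fun a => if a = i then 1 else if a = j then -m else 0, fun h => ?_, t, ?_⟩,
    (monomialMatrix (Equiv.swap i j) d, s), ⟨isGrpn_monomialMatrix hr0 _ fun a => ?_,
      fun k => ?_⟩, ?_, fun v hv => ?_⟩
  · simpa using congrFun h i
  · ext v
    have : ∀ a, (if a = i then (1 : ℂ) else if a = j then -m else 0) * v a =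
        (if a = i then v a else 0) - (if a = j then m * v a else 0) := fun a => by
      split_ifs <;> simp_all
    simp only [Set.mem_ofPred_eq, this, Finset.sum_sub_distrib]
    simp
  · dsimp only [d]
    split_ifs <;> simp [hm, hm']
  · dsimp only [s]
    split_ifs
    exacts [ht, Zlat.neg (Zlat.root_mul hr h hm' ht), Zlat.zero ξ]
  · refine ⟨Pi.single i (t + 1), fun hv => ?_⟩
    have := congrFun hv i
    simp only [applyAff, Pi.add_apply, monomialMatrix_mulVec] at this
    simp [d, s, hij.symm] at this
  · have hv : v i - m * v j = t := hv
    ext a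
    simp only [applyAff, Pi.add_apply, monomialMatrix_mulVec, d, s]
    by_cases hai : a = i
    · subst hai
      simp [← hv]
    · by_cases haj : a = j
      · subst haj
        simp only [hai, if_false, if_true, Equiv.swap_apply_right, ← hv]
        field_simp
        ring
      · simp [hai, haj, Equiv.swap_apply_of_ne_of_ne hai haj]

/-- A diagonal reflection: the hyperplane `(1 - m) x_i = t` is reflecting. -/
lemma isReflectingHyperplane_one_sub_mul {r n : ℕ} (hr : r ≠ 0) {ξ : ℂ} (i : Fin n) {m t : ℂ}
    (hm : m ^ r = 1) (hm1 : m ≠ 1) (ht : t ∈ Zlat ξ) :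
    IsReflectingHyperplane (fun g => IsGrpn r 1 n g.1 ∧ ∀ k, g.2 k ∈ Zlat ξ)
      {v : Fin n → ℂ | (1 - m) * v i = t} := by
  have hm1' : 1 - m ≠ 0 := sub_ne_zero.2 hm1.symm
  let d : Fin n → ℂ := fun a => if a = i then m else 1
  let s : Fin n → ℂ := fun a => if a = i then t else 0
  refine ⟨⟨fun a => if a = i then 1 - m else 0, fun h => hm1' ?_, t, ?_⟩,
    (monomialMatrix 1 d, s), ⟨isGrpn_monomialMatrix hr _ fun a => ?_,
      fun k => ?_⟩, ?_, fun v hv => ?_⟩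
  · simpa using congrFun h i
  · ext v
    simp
  · dsimp only [d]
    split_ifs <;> simp [hm]
  · dsimp only [s]
    split_ifs
    exacts [ht, Zlat.zero ξ]
  · refine ⟨Pi.single i ((t + 1) / (1 - m)), fun hv => ?_⟩
    have := congrFun hv i
    simp only [applyAff, Pi.add_apply, monomialMatrix_mulVec, d, s, Equiv.Perm.one_apply,
      if_true, Pi.single_eq_same] at this
    field_simp at this
    exact hm1 (by linear_combination this)
  · have hv : (1 - m) * v i = t := hv
    ext a
    simp only [applyAff, Pi.add_apply, monomialMatrix_mulVec, d, s, Equiv.Perm.one_apply]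
    by_cases hai : a = i
    · subst hai
      simp only [if_true, ← hv]
      ring
    · simp [hai]

/-- Steinberg's theorem for `[G(r,1,n)]₁`, `r ∈ {3,4,6}`, with lattice
`Λ = ℤ[ξ]e₁ + Σ_{j=2}^n ℤ[ξ](e_{j-1} - e_j)`. -/
theorem steinberg_G_r_1_n_lattice1 (r : ℕ) (hr : r = 3 ∨ r = 4 ∨ r = 6)
    (n : ℕ) (hn : 1 ≤ n)
    (ξ : ℂ) (hξ : ξ = Complex.exp (2 * Real.pi * Complex.I / (r : ℂ)))
    (Λ : Set (Fin n → ℂ))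
    (hΛ : Λ = {v | ∃ c : Fin n → ℂ, (∀ j, c j ∈ Zlat ξ) ∧ v = ∑ j, c j • stdGen n j}) :
    SteinbergProperty (fun g => IsGrpn r 1 n g.1 ∧ g.2 ∈ Λ) := by
  have hr0 : r ≠ 0 := by omega
  have hξ' : IsPrimitiveRoot ξ r := hξ ▸ Complex.isPrimitiveRoot_exp r hr0
  have hΛ' : Λ = {v | ∀ i, v i ∈ Zlat ξ} := by
    rw [hΛ]
    ext v
    exact exists_stdGen_combination_iff v
  subst hΛ'
  rintro u ⟨⟨M, t⟩, ⟨⟨hrow, -, hroot, -⟩, ht⟩, ⟨w, hw⟩, hu⟩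
  choose σ hσ hσ' using hrow
  have happ : ∀ v a, applyAff (M, t) v a = M a (σ a) * v (σ a) + t a := fun v a => by
    rw [applyAff, Pi.add_apply, Matrix.mulVec, dotProduct, Finset.sum_eq_single (σ a)]
    · intro b _ hb
      have : M a b = 0 := by
        by_contra h
        exact hb (hσ' a b h)
      simp [this]
    · simp
  have hfix : ∀ a, M a (σ a) * u (σ a) + t a = u a := fun a => by rw [← happ, hu]
  by_cases hid : ∃ i, i ≠ σ i
  · obtain ⟨i, hi⟩ := hid
    refine ⟨_, isReflectingHyperplane_sub_mul hr hξ' hi (hroot _ _ (hσ i)) (ht i), ?_⟩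
    show u i - M i (σ i) * u (σ i) = t i
    linear_combination -hfix i
  · push Not at hid
    obtain ⟨i, hi⟩ : ∃ i, M i i ≠ 1 := by
      by_contra! hall
      refine hw (funext fun a => ?_)
      have hta := hfix a
      rw [happ, ← hid a, hall]
      rw [← hid a, hall] at hta
      linear_combination hta
    have hii := hσ i
    have hui := hfix i
    rw [← hid i] at hii hui
    refine ⟨_, isReflectingHyperplane_one_sub_mul hr0 i (hroot _ _ hii) hi (ht i), ?_⟩
    show (1 - M i i) * u i = t i
    linear_combination -hui
end
end

section
/- Let ξ = e^{2πi/6} and let Λ = ℤ[ξ](ξe_1 − e_2) + ℤ[ξ](1+ξ)(e_1 − e_2) ⊆ ℂ² (a G(6,2,2)-invariant ℤ-lattice of full rank 4). Then the affine reflection group W = G(6,2,2) ⋉ Λ has the Steinberg property: every point of ℂ² fixed by some non-identity element of W lies on a reflecting hyperplane of W. -/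
open Matrix Complex

noncomputable section

/-- The Eisenstein integers `ℤ[ξ]`, as a subring of `ℂ`, for a primitive sixth root of unity `ξ`. -/
def eisenstein (ξ : ℂ) (h : ξ ^ 2 = ξ - 1) : Subring ℂ where
  carrier := Zlat ξ
  mul_mem' := by
    rintro _ _ ⟨a, b, rfl⟩ ⟨c, d, rfl⟩
    refine ⟨a * c - b * d, a * d + b * c + b * d, ?_⟩
    push_cast
    linear_combination (b * d : ℂ) * h
  one_mem' := ⟨1, 0, by simp⟩
  add_mem' := by
    rintro _ _ ⟨a, b, rfl⟩ ⟨c, d, rfl⟩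
    exact ⟨a + c, b + d, by push_cast; ring⟩
  zero_mem' := ⟨0, 0, by simp⟩
  neg_mem' := by
    rintro _ ⟨a, b, rfl⟩
    exact ⟨-a, -b, by push_cast; ring⟩

theorem self_mem_eisenstein {ξ : ℂ} (h : ξ ^ 2 = ξ - 1) : ξ ∈ eisenstein ξ h :=
  ⟨0, 1, by simp⟩

theorem exp_sixth_sq {ξ : ℂ} (hξ : ξ = Complex.exp (2 * Real.pi * Complex.I / 6)) :
    ξ ^ 2 = ξ - 1 := by
  have h1 : (2 * Real.pi * Complex.I / 6 : ℂ) = ((Real.pi / 3 : ℝ) : ℂ) * Complex.I := by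
    push_cast; ring
  rw [hξ, h1, Complex.exp_mul_I, ← Complex.ofReal_cos, ← Complex.ofReal_sin,
    Real.cos_pi_div_three, Real.sin_pi_div_three]
  have h3 : ((√3 : ℝ) : ℂ) ^ 2 = 3 := by
    rw [← Complex.ofReal_pow, Real.sq_sqrt (by norm_num)]; norm_num
  push_cast
  linear_combination (1 / 4 : ℂ) * Complex.I ^ 2 * h3 + (3 / 4 : ℂ) * Complex.I_sq

theorem one_add_ne_zero_of_sq {ξ : ℂ} (h : ξ ^ 2 = ξ - 1) : 1 + ξ ≠ 0 := by
  intro h0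
  have : (3 : ℂ) = 0 := by linear_combination h - (ξ - 2) * h0
  norm_num at this

theorem eq_of_cube_eq_one {ξ : ℂ} (h : ξ ^ 2 = ξ - 1) {c : ℂ} (hc : c ^ 3 = 1) :
    c = 1 ∨ c = ξ - 1 ∨ c = -ξ := by
  have : (c - 1) * ((c - (ξ - 1)) * (c - -ξ)) = 0 := by
    linear_combination hc - (c - 1) * h
  simpa only [mul_eq_zero, sub_eq_zero] using this

theorem eq_of_cube_eq_neg_one {ξ : ℂ} (h : ξ ^ 2 = ξ - 1) {c : ℂ} (hc : c ^ 3 = -1) :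
    c = -1 ∨ c = 1 - ξ ∨ c = ξ := by
  rcases eq_of_cube_eq_one h (c := -c) (by linear_combination -hc) with h | h | h
  · exact Or.inl (by linear_combination -h)
  · exact Or.inr (Or.inl (by linear_combination -h))
  · exact Or.inr (Or.inr (by linear_combination -h))

theorem exists_one_sub_eq {ξ : ℂ} (h : ξ ^ 2 = ξ - 1) {c : ℂ} (hc : c ^ 3 = 1) :
    ∃ k ∈ eisenstein ξ h, 1 - c = (1 + ξ) * k := by
  have hξ := self_mem_eisenstein h
  rcases eq_of_cube_eq_one h hc with rfl | rfl | rfl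
  · exact ⟨0, zero_mem _, by ring⟩
  · exact ⟨1 - ξ, sub_mem (one_mem _) hξ, by linear_combination h⟩
  · exact ⟨1, one_mem _, by ring⟩

theorem exists_one_add_eq {ξ : ℂ} (h : ξ ^ 2 = ξ - 1) {c : ℂ} (hc : c ^ 3 = -1) :
    ∃ k ∈ eisenstein ξ h, 1 + c = (1 + ξ) * k := by
  obtain ⟨k, hk, e⟩ := exists_one_sub_eq h (c := -c) (by linear_combination -hc)
  exact ⟨k, hk, by linear_combination e⟩

theorem mem_eisenstein_of_cube {ξ : ℂ} (h : ξ ^ 2 = ξ - 1) {c : ℂ} (hc : c ^ 3 = 1) :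
    c ∈ eisenstein ξ h := by
  have hξ := self_mem_eisenstein h
  rcases eq_of_cube_eq_one h hc with rfl | rfl | rfl
  · exact one_mem _
  · exact sub_mem hξ (one_mem _)
  · exact neg_mem hξ

theorem mem_eisenstein_of_cube_neg {ξ : ℂ} (h : ξ ^ 2 = ξ - 1) {c : ℂ} (hc : c ^ 3 = -1) :
    c ∈ eisenstein ξ h := by
  simpa using neg_mem (mem_eisenstein_of_cube h (c := -c) (by linear_combination -hc))

/-- The residue field `ℤ[ξ] / (1 + ξ)` has three elements. -/
theorem exists_residue_three {ξ : ℂ} (h : ξ ^ 2 = ξ - 1) {z : ℂ} (hz : z ∈ eisenstein ξ h) :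
    ∃ k ∈ eisenstein ξ h, z = (1 + ξ) * k ∨ z = (1 + ξ) * k + 1 ∨ z = (1 + ξ) * k - 1 := by
  obtain ⟨a, b, rfl⟩ := hz
  have key : ∀ m e : ℤ, a - b = 3 * m + e →
      ∃ k ∈ eisenstein ξ h, (a : ℂ) + b * ξ = (1 + ξ) * k + e := by
    intro m e hm
    have hm' : (a : ℂ) - b = 3 * m + e := by exact_mod_cast hm
    refine ⟨b + m * (2 - ξ), ⟨b + 2 * m, -m, by push_cast; ring⟩, ?_⟩
    linear_combination hm' + (m : ℂ) * h
  obtain ⟨m, hm | hm | hm⟩ : ∃ m : ℤ, a - b = 3 * m + 0 ∨ a - b = 3 * m + 1 ∨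
      a - b = 3 * m + (-1) := ⟨(a - b + 1) / 3, by omega⟩
  · obtain ⟨k, hk, e⟩ := key m _ hm
    exact ⟨k, hk, Or.inl (by simpa using e)⟩
  · obtain ⟨k, hk, e⟩ := key m _ hm
    exact ⟨k, hk, Or.inr (Or.inl (by simpa using e))⟩
  · obtain ⟨k, hk, e⟩ := key m _ hm
    exact ⟨k, hk, Or.inr (Or.inr (by rw [e]; push_cast; ring))⟩

/-- The cube roots of unity represent the units of `ℤ[ξ] / (2)`. -/
theorem exists_residue_two {ξ : ℂ} (h : ξ ^ 2 = ξ - 1) {z : ℂ} (hz : z ∈ eisenstein ξ h) :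
    ∃ k ∈ eisenstein ξ h, z = 2 * k ∨ ∃ c : ℂ, c ^ 3 = 1 ∧ z = 2 * k + c := by
  obtain ⟨a, b, rfl⟩ := hz
  have hmem : ∀ m n : ℤ, (m : ℂ) + n * ξ ∈ eisenstein ξ h := fun m n => ⟨m, n, rfl⟩
  rcases Int.even_or_odd' a with ⟨m, rfl | rfl⟩ <;> rcases Int.even_or_odd' b with ⟨n, rfl | rfl⟩
  · exact ⟨_, hmem m n, Or.inl (by push_cast; ring)⟩
  · refine ⟨_, hmem m (n + 1), Or.inr ⟨-ξ, ?_, by push_cast; ring⟩⟩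
    linear_combination -(ξ + 1) * h
  · exact ⟨_, hmem m n, Or.inr ⟨1, by ring, by push_cast; ring⟩⟩
  · refine ⟨_, hmem (m + 1) n, Or.inr ⟨ξ - 1, ?_, by push_cast; ring⟩⟩
    linear_combination (ξ - 2) * h

/-- Two half Eisenstein integers `x`, `y` with `2 * x ≡ 2 * y` modulo `1 + ξ`. -/
theorem exists_cube_root_of_half {ξ : ℂ} (h : ξ ^ 2 = ξ - 1) {x y m : ℂ}
    (hx : 2 * x ∈ eisenstein ξ h) (hy : 2 * y ∈ eisenstein ξ h) (hm : m ∈ eisenstein ξ h)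
    (e : 2 * x - 2 * y = (1 + ξ) * m) :
    x ∈ eisenstein ξ h ∨ y ∈ eisenstein ξ h ∨
      ∃ c : ℂ, c ^ 3 = 1 ∧ ∃ k ∈ eisenstein ξ h, x - c * y = (1 + ξ) * k := by
  obtain ⟨k, hk, ek | ⟨c, hc, ek⟩⟩ := exists_residue_two h hx
  · left
    rwa [show x = k by linear_combination ek / 2]
  obtain ⟨l, hl, el | ⟨d, hd, el⟩⟩ := exists_residue_two h hy
  · right; left
    rwa [show y = l by linear_combination el / 2]
  right; right
  have hξ := self_mem_eisenstein h
  have hcd : (c * d ^ 2) ^ 3 = 1 := by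
    rw [mul_pow, hc, ← pow_mul, mul_comm 2 3, pow_mul, hd]; norm_num
  have hcR := mem_eisenstein_of_cube h hcd
  obtain ⟨q, hq, eq⟩ := exists_one_sub_eq h hcd
  have h2 : (2 : ℂ) ∈ eisenstein ξ h := ofNat_mem _ 2
  refine ⟨c * d ^ 2, hcd, (2 - ξ) * (k - c * d ^ 2 * l) - (m + q * (2 * y)), ?_, ?_⟩
  · exact sub_mem (mul_mem (sub_mem h2 hξ) (sub_mem hk (mul_mem hcR hl)))
      (add_mem hm (mul_mem hq hy))
  · have e2 : x - c * d ^ 2 * y = k - c * d ^ 2 * l := by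
      linear_combination ek / 2 - c * d ^ 2 * el / 2 - c / 2 * hd
    have e3 : 2 * (x - c * d ^ 2 * y) = (1 + ξ) * (m + q * (2 * y)) := by
      linear_combination e + 2 * y * eq
    linear_combination 3 * e2 - e3 + (k - c * d ^ 2 * l) * h

/-- Two elements `x`, `y` of `(1 + ξ)⁻¹ ℤ[ξ]` with `(1 + ξ) * x ≡ (1 + ξ) * y` modulo `1 + ξ`. -/
theorem exists_cube_root_of_third {ξ : ℂ} (h : ξ ^ 2 = ξ - 1) {x y m : ℂ}
    (hy : (1 + ξ) * y ∈ eisenstein ξ h) (hm : m ∈ eisenstein ξ h)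
    (e : (1 + ξ) * x - (1 + ξ) * y = (1 + ξ) * m) :
    y ∈ eisenstein ξ h ∨
      ∃ c : ℂ, c ^ 3 = 1 ∧ ∃ k ∈ eisenstein ξ h, x - c * y = (1 + ξ) * k := by
  have hθ := one_add_ne_zero_of_sq h
  have hξ := self_mem_eisenstein h
  have e' : x - y = m := mul_left_cancel₀ hθ (by linear_combination e)
  have c1 : (ξ - 1) ^ 3 = 1 := by linear_combination (ξ - 2) * h
  have c2 : (-ξ) ^ 3 = 1 := by linear_combination -(ξ + 1) * h
  obtain ⟨l, hl, el⟩ := exists_residue_three h hy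
  obtain ⟨k, hk, ek⟩ := exists_residue_three h hm
  have h1 : (1 : ℂ) ∈ eisenstein ξ h := one_mem _
  rcases el with el | el | el
  · left
    rwa [mul_left_cancel₀ hθ el]
  · right
    rcases ek with ek | ek | ek
    · exact ⟨1, by ring, k, hk, by linear_combination e' + ek⟩
    · refine ⟨ξ - 1, c1, k + (1 - ξ) * l + (1 - ξ),
        add_mem (add_mem hk (mul_mem (sub_mem h1 hξ) hl)) (sub_mem h1 hξ), ?_⟩
      linear_combination e' + ek + (1 - ξ) * el + (y + 1) * h
    · refine ⟨-ξ, c2, k + l, add_mem hk hl, ?_⟩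
      linear_combination e' + ek + el
  · right
    rcases ek with ek | ek | ek
    · exact ⟨1, by ring, k, hk, by linear_combination e' + ek⟩
    · refine ⟨-ξ, c2, k + l, add_mem hk hl, ?_⟩
      linear_combination e' + ek + el
    · refine ⟨ξ - 1, c1, k + (1 - ξ) * l - (1 - ξ),
        sub_mem (add_mem hk (mul_mem (sub_mem h1 hξ) hl)) (sub_mem h1 hξ), ?_⟩
      linear_combination e' + ek + (1 - ξ) * el + (y - 1) * h

theorem mem_lattice_iff {ξ : ℂ} (h : ξ ^ 2 = ξ - 1) (v : Fin 2 → ℂ) :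
    (∃ c d : ℂ, c ∈ Zlat ξ ∧ d ∈ Zlat ξ ∧ v = c • ![ξ, -1] + d • ((1 + ξ) • ![1, -1])) ↔
      v 0 ∈ eisenstein ξ h ∧ v 1 ∈ eisenstein ξ h ∧
        ∃ k ∈ eisenstein ξ h, v 0 - v 1 = (1 + ξ) * k := by
  have hξ := self_mem_eisenstein h
  have h1 : (1 : ℂ) ∈ eisenstein ξ h := one_mem _
  have h2 : (2 : ℂ) ∈ eisenstein ξ h := ofNat_mem _ 2
  constructor
  · rintro ⟨c, d, hc, hd, rfl⟩
    change c ∈ eisenstein ξ h at hc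
    change d ∈ eisenstein ξ h at hd
    have hθd := mul_mem hd (add_mem h1 hξ)
    refine ⟨?_, ?_, c + 2 * d, add_mem hc (mul_mem h2 hd), ?_⟩
    · simpa using add_mem (mul_mem hc hξ) hθd
    · convert add_mem (neg_mem hc) (neg_mem hθd) using 1
      simp; ring
    · simp; ring
  · rintro ⟨hx, hy, k, hk, e⟩
    refine ⟨-ξ * (v 0 + v 1), ξ * (v 1 + k), mul_mem (neg_mem hξ) (add_mem hx hy),
      mul_mem hξ (add_mem hy hk), ?_⟩
    ext i
    fin_cases i
    · simp
      linear_combination (1 + ξ ^ 2) * e + (v 1 + k * (1 + ξ)) * h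
    · simp
      linear_combination -ξ * e + v 1 * h

theorem isGrpn_six_two_two_iff (M : Matrix (Fin 2) (Fin 2) ℂ) :
    IsGrpn 6 2 2 M ↔ ∃ a b : ℂ, (M = !![a, 0; 0, b] ∨ M = !![0, a; b, 0]) ∧
      a ^ 6 = 1 ∧ b ^ 6 = 1 ∧ (a * b) ^ 3 = 1 := by
  constructor
  · rintro ⟨hr, hc, h6, h3⟩
    obtain ⟨j, hj, uj⟩ := hr 0
    obtain ⟨k, hk, uk⟩ := hr 1
    obtain ⟨i, hi, ui⟩ := hc j
    simp only [Fin.prod_univ_two, Fin.sum_univ_two] at h3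
    have z0 : ∀ l, l ≠ j → M 0 l = 0 := fun l hl => by
      by_contra hne; exact hl (uj l hne)
    have z1 : ∀ l, l ≠ k → M 1 l = 0 := fun l hl => by
      by_contra hne; exact hl (uk l hne)
    have hjk : j ≠ k := by
      rintro rfl
      exact absurd ((ui 0 hj).trans (ui 1 hk).symm) (by decide)
    refine ⟨M 0 j, M 1 k, ?_, h6 _ _ hj, h6 _ _ hk, ?_⟩
    · fin_cases j <;> fin_cases k
      · exact absurd rfl hjk
      · left
        ext a b
        fin_cases a <;> fin_cases b <;> simp [z0, z1]
      · right
        ext a b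
        fin_cases a <;> fin_cases b <;> simp [z0, z1]
      · exact absurd rfl hjk
    · fin_cases j <;> fin_cases k
      · exact absurd rfl hjk
      · simpa [z0, z1] using h3
      · simpa [z0, z1] using h3
      · exact absurd rfl hjk
  · rintro ⟨a, b, hM, ha, hb, hab⟩
    have ha0 : a ≠ 0 := by rintro rfl; norm_num at ha
    have hb0 : b ≠ 0 := by rintro rfl; norm_num at hb
    rcases hM with rfl | rfl <;>
      simp [IsGrpn, ExistsUnique, Fin.forall_fin_two, Fin.exists_fin_two, ha0, hb0, ha, hb, hab]

theorem exists_hyperplane_of_fst_mem {ξ : ℂ} (h : ξ ^ 2 = ξ - 1) {Λ : Set (Fin 2 → ℂ)}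
    (hΛ : ∀ v, v ∈ Λ ↔ v 0 ∈ eisenstein ξ h ∧ v 1 ∈ eisenstein ξ h ∧
      ∃ k ∈ eisenstein ξ h, v 0 - v 1 = (1 + ξ) * k) {u : Fin 2 → ℂ}
    (hu : u 0 ∈ eisenstein ξ h) :
    ∃ H, IsReflectingHyperplane (fun g => IsGrpn 6 2 2 g.1 ∧ g.2 ∈ Λ) H ∧ u ∈ H := by
  have hξ := self_mem_eisenstein h
  have hθ : 1 + ξ ∈ eisenstein ξ h := add_mem (one_mem _) hξ
  refine ⟨{v | ∑ i, ![1, 0] i * v i = u 0}, ⟨⟨![1, 0], ?_, u 0, rfl⟩,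
    (!![-ξ, 0; 0, 1], ![(1 + ξ) * u 0, 0]), ⟨?_, ?_⟩, ⟨![u 0 + 1, 0], ?_⟩, ?_⟩, by simp⟩
  · intro h0
    simpa using congrFun h0 0
  · have h3 : ξ ^ 3 = -1 := by linear_combination (ξ + 1) * h
    refine (isGrpn_six_two_two_iff _).2 ⟨-ξ, 1, Or.inl rfl, ?_, by norm_num, ?_⟩
    · linear_combination (ξ ^ 3 - 1) * h3
    · linear_combination -h3
  · rw [hΛ]
    exact ⟨mul_mem hθ hu, zero_mem _, u 0, hu, by simp⟩
  · intro h0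
    have h0 := congrFun h0 0
    simp [applyAff, vecHead] at h0
    exact one_add_ne_zero_of_sq h (by linear_combination -h0)
  · intro v hv
    have hv : v 0 = u 0 := by simpa using hv
    ext i
    fin_cases i
    · simp [applyAff, vecHead, vecTail, hv]; ring
    · simp [applyAff, vecHead, vecTail]

theorem exists_hyperplane_of_snd_mem {ξ : ℂ} (h : ξ ^ 2 = ξ - 1) {Λ : Set (Fin 2 → ℂ)}
    (hΛ : ∀ v, v ∈ Λ ↔ v 0 ∈ eisenstein ξ h ∧ v 1 ∈ eisenstein ξ h ∧
      ∃ k ∈ eisenstein ξ h, v 0 - v 1 = (1 + ξ) * k) {u : Fin 2 → ℂ}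
    (hu : u 1 ∈ eisenstein ξ h) :
    ∃ H, IsReflectingHyperplane (fun g => IsGrpn 6 2 2 g.1 ∧ g.2 ∈ Λ) H ∧ u ∈ H := by
  have hξ := self_mem_eisenstein h
  have hθ : 1 + ξ ∈ eisenstein ξ h := add_mem (one_mem _) hξ
  refine ⟨{v | ∑ i, ![0, 1] i * v i = u 1}, ⟨⟨![0, 1], ?_, u 1, rfl⟩,
    (!![1, 0; 0, -ξ], ![0, (1 + ξ) * u 1]), ⟨?_, ?_⟩, ⟨![0, u 1 + 1], ?_⟩, ?_⟩, by simp⟩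
  · intro h0
    simpa using congrFun h0 1
  · have h3 : ξ ^ 3 = -1 := by linear_combination (ξ + 1) * h
    refine (isGrpn_six_two_two_iff _).2 ⟨1, -ξ, Or.inl rfl, by norm_num, ?_, ?_⟩
    · linear_combination (ξ ^ 3 - 1) * h3
    · linear_combination -h3
  · rw [hΛ]
    exact ⟨zero_mem _, mul_mem hθ hu, -u 1, neg_mem hu, by simp⟩
  · intro h0
    have h0 := congrFun h0 1
    simp [applyAff, vecHead, vecTail] at h0
    exact one_add_ne_zero_of_sq h (by linear_combination -h0)
  · intro v hv
    have hv : v 1 = u 1 := by simpa using hv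
    ext i
    fin_cases i
    · simp [applyAff, vecHead, vecTail]
    · simp [applyAff, vecHead, vecTail, hv]; ring

theorem exists_hyperplane_of_swap {Λ : Set (Fin 2 → ℂ)} {u : Fin 2 → ℂ} {c d : ℂ}
    (hc : c ^ 6 = 1) (hcd : c * d = 1)
    (hu : ![u 0 - c * u 1, -d * (u 0 - c * u 1)] ∈ Λ) :
    ∃ H, IsReflectingHyperplane (fun g => IsGrpn 6 2 2 g.1 ∧ g.2 ∈ Λ) H ∧ u ∈ H := by
  refine ⟨{v | ∑ i, ![1, -c] i * v i = u 0 - c * u 1},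
    ⟨⟨![1, -c], ?_, u 0 - c * u 1, rfl⟩,
    (!![0, c; d, 0], ![u 0 - c * u 1, -d * (u 0 - c * u 1)]), ⟨?_, hu⟩,
    ⟨![u 0 - c * u 1 + 1, 0], ?_⟩, ?_⟩, by simp; ring⟩
  · intro h0
    simpa using congrFun h0 0
  · refine (isGrpn_six_two_two_iff _).2 ⟨c, d, Or.inr rfl, hc, ?_, ?_⟩
    · calc d ^ 6 = c ^ 6 * d ^ 6 := by rw [hc, one_mul]
        _ = 1 := by rw [← mul_pow, hcd, one_pow]
    · rw [hcd, one_pow]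
  · intro h0
    have h0 := congrFun h0 0
    simp [applyAff, vecHead] at h0
  · intro v hv
    have hv : v 0 - c * v 1 = u 0 - c * u 1 := by
      have hv : v 0 + -(c * v 1) = u 0 - c * u 1 := by simpa using hv
      linear_combination hv
    ext i
    fin_cases i
    · simp [applyAff, vecHead, vecTail]; linear_combination -hv
    · simp [applyAff, vecHead, vecTail]; linear_combination d * hv + v 1 * hcd

theorem exists_hyperplane_of_sub_cube_root_mul {ξ : ℂ} (h : ξ ^ 2 = ξ - 1) {Λ : Set (Fin 2 → ℂ)}
    (hΛ : ∀ v, v ∈ Λ ↔ v 0 ∈ eisenstein ξ h ∧ v 1 ∈ eisenstein ξ h ∧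
      ∃ k ∈ eisenstein ξ h, v 0 - v 1 = (1 + ξ) * k) {u : Fin 2 → ℂ}
    (hu : ∃ c : ℂ, c ^ 3 = 1 ∧ ∃ k ∈ eisenstein ξ h, u 0 - c * u 1 = (1 + ξ) * k) :
    ∃ H, IsReflectingHyperplane (fun g => IsGrpn 6 2 2 g.1 ∧ g.2 ∈ Λ) H ∧ u ∈ H := by
  obtain ⟨c, hc, k, hk, e⟩ := hu
  have hθ : 1 + ξ ∈ eisenstein ξ h := add_mem (one_mem _) (self_mem_eisenstein h)
  have hd := mem_eisenstein_of_cube h (c := c ^ 2) (by linear_combination (c ^ 3 + 1) * hc)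
  refine exists_hyperplane_of_swap (c := c) (d := c ^ 2)
    (by linear_combination (c ^ 3 + 1) * hc) (by linear_combination hc) ?_
  rw [hΛ, e]
  exact ⟨mul_mem hθ hk, mul_mem (neg_mem hd) (mul_mem hθ hk), k + c ^ 2 * k,
    add_mem hk (mul_mem hd hk), by simp; ring⟩

theorem exists_hyperplane_of_add_mem {ξ : ℂ} (h : ξ ^ 2 = ξ - 1) {Λ : Set (Fin 2 → ℂ)}
    (hΛ : ∀ v, v ∈ Λ ↔ v 0 ∈ eisenstein ξ h ∧ v 1 ∈ eisenstein ξ h ∧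
      ∃ k ∈ eisenstein ξ h, v 0 - v 1 = (1 + ξ) * k) {u : Fin 2 → ℂ}
    (hu : u 0 + u 1 ∈ eisenstein ξ h) :
    ∃ H, IsReflectingHyperplane (fun g => IsGrpn 6 2 2 g.1 ∧ g.2 ∈ Λ) H ∧ u ∈ H := by
  refine exists_hyperplane_of_swap (c := -1) (d := -1) (by norm_num) (by norm_num) ?_
  rw [hΛ]
  have e : u 0 - -1 * u 1 = u 0 + u 1 := by ring
  simpa [e] using ⟨hu, 0, zero_mem _, Or.inr rfl⟩

theorem exists_hyperplane_of_third {ξ : ℂ} (h : ξ ^ 2 = ξ - 1) {Λ : Set (Fin 2 → ℂ)}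
    (hΛ : ∀ v, v ∈ Λ ↔ v 0 ∈ eisenstein ξ h ∧ v 1 ∈ eisenstein ξ h ∧
      ∃ k ∈ eisenstein ξ h, v 0 - v 1 = (1 + ξ) * k) {u : Fin 2 → ℂ}
    {m : ℂ} (hy : (1 + ξ) * u 1 ∈ eisenstein ξ h) (hm : m ∈ eisenstein ξ h)
    (e : (1 + ξ) * u 0 - (1 + ξ) * u 1 = (1 + ξ) * m) :
    ∃ H, IsReflectingHyperplane (fun g => IsGrpn 6 2 2 g.1 ∧ g.2 ∈ Λ) H ∧ u ∈ H := by
  rcases exists_cube_root_of_third h hy hm e with h1 | h1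
  · exact exists_hyperplane_of_snd_mem h hΛ h1
  · exact exists_hyperplane_of_sub_cube_root_mul h hΛ h1

/-- Points `u` with `(1 - c) • u ∈ Λ` for some nontrivial cube root of unity `c`. -/
theorem exists_hyperplane_of_one_sub_mul {ξ : ℂ} (h : ξ ^ 2 = ξ - 1) {Λ : Set (Fin 2 → ℂ)}
    (hΛ : ∀ v, v ∈ Λ ↔ v 0 ∈ eisenstein ξ h ∧ v 1 ∈ eisenstein ξ h ∧
      ∃ k ∈ eisenstein ξ h, v 0 - v 1 = (1 + ξ) * k) {u : Fin 2 → ℂ}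
    {c s t m : ℂ} (hc : c ^ 3 = 1) (hc1 : c ≠ 1) (ht : t ∈ eisenstein ξ h)
    (hm : m ∈ eisenstein ξ h) (ex : (1 - c) * u 0 = s) (ey : (1 - c) * u 1 = t)
    (e : s - t = (1 + ξ) * m) :
    ∃ H, IsReflectingHyperplane (fun g => IsGrpn 6 2 2 g.1 ∧ g.2 ∈ Λ) H ∧ u ∈ H := by
  have hξ := self_mem_eisenstein h
  subst ex ey
  rcases eq_of_cube_eq_one h hc with rfl | rfl | rfl
  · exact absurd rfl hc1
  · refine exists_hyperplane_of_third h hΛ (m := ξ * m) ?_ (mul_mem hξ hm) ?_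
    · convert mul_mem hξ ht using 1
      linear_combination u 1 * h
    · linear_combination ξ * e + (u 0 - u 1) * h
  · refine exists_hyperplane_of_third h hΛ (m := m) ?_ hm ?_
    · simpa using ht
    · linear_combination e

theorem exists_hyperplane_of_diagonal {ξ : ℂ} (h : ξ ^ 2 = ξ - 1) {Λ : Set (Fin 2 → ℂ)}
    (hΛ : ∀ v, v ∈ Λ ↔ v 0 ∈ eisenstein ξ h ∧ v 1 ∈ eisenstein ξ h ∧
      ∃ k ∈ eisenstein ξ h, v 0 - v 1 = (1 + ξ) * k) {u : Fin 2 → ℂ}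
    {a b s t k : ℂ} (ha : a ^ 6 = 1) (hab : (a * b) ^ 3 = 1) (hne : ¬(a = 1 ∧ b = 1))
    (hs : s ∈ eisenstein ξ h) (ht : t ∈ eisenstein ξ h) (hk : k ∈ eisenstein ξ h)
    (ek : s - t = (1 + ξ) * k) (ex : (1 - a) * u 0 = s) (ey : (1 - b) * u 1 = t) :
    ∃ H, IsReflectingHyperplane (fun g => IsGrpn 6 2 2 g.1 ∧ g.2 ∈ Λ) H ∧ u ∈ H := by
  have hξ := self_mem_eisenstein h
  have h1 : (1 : ℂ) ∈ eisenstein ξ h := one_mem _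
  have hθ := one_add_ne_zero_of_sq h
  have hcases : (a ^ 3 = 1 ∧ b ^ 3 = 1) ∨ (a ^ 3 = -1 ∧ b ^ 3 = -1) := by
    have : (a ^ 3 - 1) * (a ^ 3 + 1) = 0 := by linear_combination ha
    rcases mul_eq_zero.1 this with h | h
    · exact Or.inl ⟨by linear_combination h, by linear_combination hab - b ^ 3 * h⟩
    · exact Or.inr ⟨by linear_combination h, by linear_combination -hab + b ^ 3 * h⟩
  rcases hcases with ⟨ha3, hb3⟩ | ⟨ha3, hb3⟩
  · by_cases ha1 : a = 1
    · subst ha1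
      have hb1 : b ≠ 1 := fun hb => hne ⟨rfl, hb⟩
      have hs0 : s = 0 := by rw [← ex]; ring
      refine exists_hyperplane_of_snd_mem h hΛ ?_
      rcases eq_of_cube_eq_one h hb3 with rfl | rfl | rfl
      · exact absurd rfl hb1
      · convert neg_mem (mul_mem hξ hk) using 1
        refine mul_left_cancel₀ hθ ?_
        linear_combination ξ * ey - ξ * ek + ξ * hs0 + u 1 * h
      · convert neg_mem hk using 1
        refine mul_left_cancel₀ hθ ?_
        linear_combination ey - ek + hs0
    by_cases hb1 : b = 1
    · subst hb1
      have ht0 : t = 0 := by rw [← ey]; ring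
      refine exists_hyperplane_of_fst_mem h hΛ ?_
      rcases eq_of_cube_eq_one h ha3 with rfl | rfl | rfl
      · exact absurd rfl ha1
      · convert mul_mem hξ hk using 1
        refine mul_left_cancel₀ hθ ?_
        linear_combination ξ * ex + ξ * ek + ξ * ht0 + u 0 * h
      · convert hk using 1
        refine mul_left_cancel₀ hθ ?_
        linear_combination ex + ek + ht0
    by_cases hEq : a = b
    · subst hEq
      exact exists_hyperplane_of_one_sub_mul h hΛ ha3 ha1 ht hk ex ey ek
    · refine exists_hyperplane_of_add_mem h hΛ ?_
      rcases eq_of_cube_eq_one h ha3 with rfl | rfl | rfl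
      · exact absurd rfl ha1
      · rcases eq_of_cube_eq_one h hb3 with rfl | rfl | rfl
        · exact absurd rfl hb1
        · exact absurd rfl hEq
        · convert sub_mem hs hk using 1
          refine mul_left_cancel₀ hθ ?_
          linear_combination ξ * ex + ey - ek + u 0 * h
      · rcases eq_of_cube_eq_one h hb3 with rfl | rfl | rfl
        · exact absurd rfl hb1
        · convert add_mem ht hk using 1
          refine mul_left_cancel₀ hθ ?_
          linear_combination ex + ξ * ey + ek + u 1 * h
        · exact absurd rfl hEq
  · rcases eq_of_cube_eq_neg_one h ha3 with rfl | rfl | eq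
    · rcases eq_of_cube_eq_neg_one h hb3 with rfl | rfl | eq
      · rw [show (1 - -1 : ℂ) = 2 by norm_num] at ex ey
        rw [← ex] at hs ek
        rw [← ey] at ht ek
        rcases exists_cube_root_of_half h hs ht hk ek with h2 | h2 | h2
        · exact exists_hyperplane_of_fst_mem h hΛ h2
        · exact exists_hyperplane_of_snd_mem h hΛ h2
        · exact exists_hyperplane_of_sub_cube_root_mul h hΛ h2
      · refine exists_hyperplane_of_snd_mem h hΛ ?_
        convert mul_mem (sub_mem h1 hξ) ht using 1
        linear_combination (1 - ξ) * ey + u 1 * h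
      · refine exists_hyperplane_of_snd_mem h hΛ ?_
        convert mul_mem hξ ht using 1
        linear_combination ξ * ey + u 1 * h + u 1 * ξ * eq
    · refine exists_hyperplane_of_fst_mem h hΛ ?_
      convert mul_mem (sub_mem h1 hξ) hs using 1
      linear_combination (1 - ξ) * ex + u 0 * h
    · refine exists_hyperplane_of_fst_mem h hΛ ?_
      convert mul_mem hξ hs using 1
      linear_combination ξ * ex + u 0 * h + u 0 * ξ * eq

theorem exists_hyperplane_of_antidiagonal {ξ : ℂ} (h : ξ ^ 2 = ξ - 1) {Λ : Set (Fin 2 → ℂ)}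
    (hΛ : ∀ v, v ∈ Λ ↔ v 0 ∈ eisenstein ξ h ∧ v 1 ∈ eisenstein ξ h ∧
      ∃ k ∈ eisenstein ξ h, v 0 - v 1 = (1 + ξ) * k) {u : Fin 2 → ℂ}
    {a b s t k : ℂ} (ha : a ^ 6 = 1) (hab : (a * b) ^ 3 = 1)
    (hst : ![s, t] ∈ Λ) (hs : s ∈ eisenstein ξ h) (ht : t ∈ eisenstein ξ h)
    (hk : k ∈ eisenstein ξ h) (ek : s - t = (1 + ξ) * k)
    (ex : a * u 1 + s = u 0) (ey : b * u 0 + t = u 1) :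
    ∃ H, IsReflectingHyperplane (fun g => IsGrpn 6 2 2 g.1 ∧ g.2 ∈ Λ) H ∧ u ∈ H := by
  by_cases hab1 : a * b = 1
  · refine exists_hyperplane_of_swap ha hab1 ?_
    convert hst using 2
    · linear_combination -ex
    · congr 1
      linear_combination -ey + u 1 * hab1
  have ex' : (1 - a * b) * u 0 = s + a * t := by linear_combination -ex - a * ey
  have ey' : (1 - a * b) * u 1 = t + b * s := by linear_combination -ey - b * ex
  have : (a ^ 3 - 1) * (a ^ 3 + 1) = 0 := by linear_combination ha
  rcases mul_eq_zero.1 this with h3 | h3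
  · have ha3 : a ^ 3 = 1 := by linear_combination h3
    have hb3 : b ^ 3 = 1 := by linear_combination hab - b ^ 3 * h3
    obtain ⟨p, hp, ep⟩ := exists_one_sub_eq h ha3
    obtain ⟨q, hq, eq⟩ := exists_one_sub_eq h hb3
    refine exists_hyperplane_of_one_sub_mul h hΛ hab hab1
      (add_mem ht (mul_mem (mem_eisenstein_of_cube h hb3) hs))
      (sub_mem (mul_mem hq hs) (mul_mem hp ht)) ex' ey' ?_
    linear_combination s * eq - t * ep
  · have ha3 : a ^ 3 = -1 := by linear_combination h3
    have hb3 : b ^ 3 = -1 := by linear_combination -hab + b ^ 3 * h3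
    obtain ⟨p, hp, ep⟩ := exists_one_add_eq h ha3
    obtain ⟨q, hq, eq⟩ := exists_one_add_eq h hb3
    refine exists_hyperplane_of_one_sub_mul h hΛ hab hab1
      (add_mem ht (mul_mem (mem_eisenstein_of_cube_neg h hb3) hs))
      (add_mem (add_mem hk hk) (sub_mem (mul_mem hp ht) (mul_mem hq hs))) ex' ey' ?_
    linear_combination 2 * ek + t * ep - s * eq

/-- Steinberg's theorem for `[G(6,2,2)]₂` with lattice
`Λ = ℤ[ξ](ξe₁ - e₂) + ℤ[ξ](1+ξ)(e₁ - e₂)`, where `ξ = e^{2πi/6}`. -/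
theorem steinberg_G_6_2_2_lattice2
    (ξ : ℂ) (hξ : ξ = Complex.exp (2 * Real.pi * Complex.I / 6))
    (Λ : Set (Fin 2 → ℂ))
    (hΛ : Λ = {v | ∃ c d : ℂ, c ∈ Zlat ξ ∧ d ∈ Zlat ξ ∧
      v = c • ![ξ, -1] + d • ((1 + ξ) • ![1, -1])}) :
    SteinbergProperty (fun g => IsGrpn 6 2 2 g.1 ∧ g.2 ∈ Λ) := by
  have h := exp_sixth_sq hξ
  have hΛ' : ∀ v, v ∈ Λ ↔ v 0 ∈ eisenstein ξ h ∧ v 1 ∈ eisenstein ξ h ∧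
      ∃ k ∈ eisenstein ξ h, v 0 - v 1 = (1 + ξ) * k := by
    intro v
    rw [hΛ]
    exact mem_lattice_iff h v
  rintro u ⟨⟨M, w⟩, ⟨hM, hw⟩, ⟨v, hv⟩, hu⟩
  have hw' := (hΛ' w).1 hw
  obtain ⟨hs, ht, k, hk, ek⟩ := hw'
  have h0 := congrFun hu 0
  have h1 := congrFun hu 1
  obtain ⟨a, b, rfl | rfl, ha, -, hab⟩ := (isGrpn_six_two_two_iff M).1 hM
  · simp [applyAff, vecHead, vecTail] at h0 h1
    refine exists_hyperplane_of_diagonal h hΛ' ha hab ?_ hs ht hk ek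
      (by linear_combination -h0) (by linear_combination -h1)
    rintro ⟨rfl, rfl⟩
    refine hv ?_
    ext i
    fin_cases i
    · simp [applyAff, vecHead, vecTail]; linear_combination h0
    · simp [applyAff, vecHead, vecTail]; linear_combination h1
  · simp [applyAff, vecHead, vecTail] at h0 h1
    refine exists_hyperplane_of_antidiagonal h hΛ' ha hab ?_ hs ht hk ek h0 h1
    convert hw using 1
    ext i
    fin_cases i <;> rfl
end
end

section
/- Let Λ = ℤ[i](ie_1 − e_2) + ℤ[i](1+i)(e_1 − e_2) ⊆ ℂ² (a G(4,2,2)-invariant ℤ-lattice of full rank 4). Then the affine reflection group W = G(4,2,2) ⋉ Λ has the Steinberg property: every point of ℂ² fixed by some non-identity element of W lies on a reflecting hyperplane of W. -/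
open Matrix Complex

noncomputable section

lemma add_mem_Zlat_I {z w : ℂ} (hz : z ∈ Zlat I) (hw : w ∈ Zlat I) : z + w ∈ Zlat I := by
  obtain ⟨a, b, rfl⟩ := hz
  obtain ⟨c, d, rfl⟩ := hw
  exact ⟨a + c, b + d, by push_cast; ring⟩

lemma mul_mem_Zlat_I {z w : ℂ} (hz : z ∈ Zlat I) (hw : w ∈ Zlat I) : z * w ∈ Zlat I := by
  obtain ⟨a, b, rfl⟩ := hz
  obtain ⟨c, d, rfl⟩ := hw
  exact ⟨a * c - b * d, a * d + b * c, by push_cast; linear_combination (b * d : ℂ) * I_sq⟩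

lemma eq_of_pow_four_eq_one {z : ℂ} (h : z ^ 4 = 1) : z = 1 ∨ z = -1 ∨ z = I ∨ z = -I := by
  have key : (z - 1) * ((z + 1) * ((z - I) * (z + I))) = 0 := by
    linear_combination h - (z ^ 2 - 1) * I_sq
  simpa only [mul_eq_zero, sub_eq_zero, ← eq_neg_iff_add_eq_zero] using key

lemma IsGrpn.eq_diag_or_antidiag {M : Matrix (Fin 2) (Fin 2) ℂ} (h : IsGrpn 4 2 2 M) :
    ∃ α β : ℂ, α ^ 4 = 1 ∧ β ^ 4 = 1 ∧ (α * β) ^ 2 = 1 ∧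
      (M = !![α, 0; 0, β] ∨ M = !![0, α; β, 0]) := by
  obtain ⟨hrow, hcol, hroot, hprod⟩ := h
  simp only [Fin.prod_univ_two, Fin.sum_univ_two] at hprod
  norm_num at hprod
  have offrow : ∀ i j k, j ≠ k → M i j ≠ 0 → M i k = 0 := fun i j k hjk hj => by
    by_contra hk
    exact hjk ((hrow i).unique hj hk)
  have offcol : ∀ i j k, i ≠ k → M i j ≠ 0 → M k j = 0 := fun i j k hik hi => by
    by_contra hk
    exact hik ((hcol j).unique hi hk)
  by_cases h00 : M 0 0 = 0
  · obtain ⟨j, hj, -⟩ := hrow 0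
    obtain ⟨i, hi, -⟩ := hcol 0
    have h01 : M 0 1 ≠ 0 := by fin_cases j <;> simp_all
    have h10 : M 1 0 ≠ 0 := by fin_cases i <;> simp_all
    have h11 : M 1 1 = 0 := offcol 0 1 1 (by decide) h01
    refine ⟨M 0 1, M 1 0, hroot _ _ h01, hroot _ _ h10, ?_, Or.inr ?_⟩
    · simpa [h00, h11] using hprod
    · ext i j; fin_cases i <;> fin_cases j <;> simp [h00, h11]
  · have h01 : M 0 1 = 0 := offrow 0 0 1 (by decide) h00
    have h10 : M 1 0 = 0 := offcol 0 0 1 (by decide) h00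
    obtain ⟨j, hj, -⟩ := hrow 1
    have h11 : M 1 1 ≠ 0 := by fin_cases j <;> simp_all
    refine ⟨M 0 0, M 1 1, hroot _ _ h00, hroot _ _ h11, ?_, Or.inl ?_⟩
    · simpa [h01, h10] using hprod
    · ext i j; fin_cases i <;> fin_cases j <;> simp [h01, h10]

lemma isGrpn_antidiag_I : IsGrpn 4 2 2 !![0, I; -I, 0] := by
  refine ⟨?_, ?_, ?_, ?_⟩
  · intro i; fin_cases i
    · exact ⟨1, by simp, fun j => by fin_cases j <;> simp⟩
    · exact ⟨0, by simp, fun j => by fin_cases j <;> simp⟩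
  · intro i; fin_cases i
    · exact ⟨1, by simp, fun j => by fin_cases j <;> simp⟩
    · exact ⟨0, by simp, fun j => by fin_cases j <;> simp⟩
  · intro i j
    fin_cases i <;> fin_cases j <;> simp [Even.neg_pow (show Even 4 by decide)]
  · simp [Fin.prod_univ_two]

lemma exists_isReflectingHyperplane_of_fixed
    {W : Matrix (Fin 2) (Fin 2) ℂ × (Fin 2 → ℂ) → Prop}
    {g : Matrix (Fin 2) (Fin 2) ℂ × (Fin 2 → ℂ)} (hg : W g) (hne : ∃ v, applyAff g v ≠ v)
    {a b : ℂ} (hab : a ≠ 0 ∨ b ≠ 0) {u : Fin 2 → ℂ}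
    (hfix : ∀ v : Fin 2 → ℂ, a * v 0 + b * v 1 = a * u 0 + b * u 1 → applyAff g v = v) :
    ∃ H, IsReflectingHyperplane W H ∧ u ∈ H := by
  refine ⟨{v | ∑ i, ![a, b] i * v i = a * u 0 + b * u 1},
    ⟨⟨![a, b], ?_, _, rfl⟩, g, hg, hne, fun v hv => hfix v (by simpa using hv)⟩, by simp⟩
  intro h
  have h0 := congrFun h 0
  have h1 := congrFun h 1
  simp at h0 h1
  tauto

lemma applyAff_diag_eq_iff {α β : ℂ} {t v : Fin 2 → ℂ} :
    applyAff (!![α, 0; 0, β], t) v = v ↔ α * v 0 + t 0 = v 0 ∧ β * v 1 + t 1 = v 1 := by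
  simp [applyAff, funext_iff, Fin.forall_fin_two, Matrix.vecHead, Matrix.vecTail]

lemma applyAff_antidiag_eq_iff {α β : ℂ} {t v : Fin 2 → ℂ} :
    applyAff (!![0, α; β, 0], t) v = v ↔ α * v 1 + t 0 = v 0 ∧ β * v 0 + t 1 = v 1 := by
  simp [applyAff, funext_iff, Fin.forall_fin_two, Matrix.vecHead, Matrix.vecTail]

/-- A point of the hyperplane `x₁ - i x₂ = k` with `k ∈ ℤ[i]` is fixed by a reflection with linear
part `!![0, i; -i, 0]` and translation part in `ℤ[i](ie₁ - e₂)`. -/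
lemma exists_isReflectingHyperplane_of_mem_Zlat_I
    {W : Matrix (Fin 2) (Fin 2) ℂ × (Fin 2 → ℂ) → Prop}
    (hW : ∀ c ∈ Zlat I, W (!![0, I; -I, 0], c • ![I, -1]))
    {u : Fin 2 → ℂ} (hu : u 0 - I * u 1 ∈ Zlat I) :
    ∃ H, IsReflectingHyperplane W H ∧ u ∈ H := by
  have hc : (-I) * (u 0 - I * u 1) ∈ Zlat I := mul_mem_Zlat_I ⟨0, -1, by simp⟩ hu
  refine exists_isReflectingHyperplane_of_fixed (hW _ hc) ⟨u + ![1, 0], ?_⟩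
    (a := 1) (b := -I) (Or.inl one_ne_zero) fun v hv => ?_
  · rw [Ne, applyAff_antidiag_eq_iff]
    rintro ⟨h, -⟩
    simp at h
    have h' : (1 : ℂ) = 0 := by linear_combination -h - (u 0 - I * u 1) * I_sq
    exact one_ne_zero h'
  · rw [applyAff_antidiag_eq_iff]
    simp
    constructor
    · linear_combination -hv - (u 0 - I * u 1) * I_sq
    · linear_combination -I * hv - v 1 * I_sq

/-- Steinberg's theorem for `[G(4,2,2)]₃` with lattice
`Λ = ℤ[i](ie₁ - e₂) + ℤ[i](1+i)(e₁ - e₂)`. -/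
theorem steinberg_G_4_2_2_lattice3
    (Λ : Set (Fin 2 → ℂ))
    (hΛ : Λ = {v | ∃ c d : ℂ, c ∈ Zlat Complex.I ∧ d ∈ Zlat Complex.I ∧
      v = c • ![Complex.I, -1] + d • ((1 + Complex.I) • ![1, -1])}) :
    SteinbergProperty (fun g => IsGrpn 4 2 2 g.1 ∧ g.2 ∈ Λ) := by
  have hI : I ∈ Zlat I := ⟨0, 1, by simp⟩
  have hnI : -I ∈ Zlat I := ⟨0, -1, by simp⟩
  have hone : (1 : ℂ) ∈ Zlat I := ⟨1, 0, by simp⟩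
  have hnone : (-1 : ℂ) ∈ Zlat I := ⟨-1, 0, by simp⟩
  rintro u ⟨⟨M, t⟩, ⟨hM, ht⟩, hne, hfix⟩
  have hg : IsGrpn 4 2 2 M ∧ t ∈ Λ := ⟨hM, ht⟩
  have hspecial := exists_isReflectingHyperplane_of_mem_Zlat_I
    (W := fun g => IsGrpn 4 2 2 g.1 ∧ g.2 ∈ Λ) (u := u) fun c hc =>
      ⟨isGrpn_antidiag_I, by rw [hΛ]; exact ⟨c, 0, hc, ⟨0, 0, by simp⟩, by simp⟩⟩
  simp only at hM ht
  rw [hΛ] at ht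
  obtain ⟨c, d, hc, hd, htcd⟩ := ht
  have ht0 : t 0 = c * I + d * (1 + I) := by simp [htcd]
  have ht1 : t 1 = -c - d * (1 + I) := by simp [htcd]; ring
  have hcd := add_mem_Zlat_I hc hd
  have finish : ∀ e ∈ Zlat I, u 0 - I * u 1 = e → u 0 - I * u 1 ∈ Zlat I :=
    fun e he h => h ▸ he
  obtain ⟨α, β, hα, hβ, hαβ, rfl | rfl⟩ := hM.eq_diag_or_antidiag
  · obtain ⟨h0, h1⟩ := applyAff_diag_eq_iff.1 hfix
    by_cases hα1 : α = 1
    · refine exists_isReflectingHyperplane_of_fixed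
        (W := fun g => IsGrpn 4 2 2 g.1 ∧ g.2 ∈ Λ) hg hne (a := 0) (b := 1) (Or.inr one_ne_zero) fun v hv =>
          applyAff_diag_eq_iff.2 ?_
      simp only [zero_mul, one_mul, zero_add] at hv
      exact ⟨by subst hα1; linear_combination h0, by rw [hv]; exact h1⟩
    by_cases hβ1 : β = 1
    · refine exists_isReflectingHyperplane_of_fixed
        (W := fun g => IsGrpn 4 2 2 g.1 ∧ g.2 ∈ Λ) hg hne (a := 1) (b := 0) (Or.inl one_ne_zero) fun v hv =>
          applyAff_diag_eq_iff.2 ?_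
      simp only [zero_mul, one_mul, add_zero] at hv
      exact ⟨by rw [hv]; exact h0, by subst hβ1; linear_combination h1⟩
    apply hspecial
    rcases eq_of_pow_four_eq_one hα with rfl | rfl | rfl | rfl <;>
      rcases eq_of_pow_four_eq_one hβ with rfl | rfl | rfl | rfl <;>
      first
      | exact absurd rfl hα1
      | exact absurd rfl hβ1
      | (exfalso; norm_num [mul_pow] at hαβ; done)
      | skip
    · exact finish (I * (c + d)) (mul_mem_Zlat_I hI hcd) (by grind [I_sq])
    · exact finish ((1 + I) * (I * (c + d)))
        (mul_mem_Zlat_I (add_mem_Zlat_I hone hI) (mul_mem_Zlat_I hI hcd)) (by grind [I_sq])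
    · exact finish (I * (c + (d + d)))
        (mul_mem_Zlat_I hI (add_mem_Zlat_I hc (add_mem_Zlat_I hd hd))) (by grind [I_sq])
    · exact finish (I * c) (mul_mem_Zlat_I hI hc) (by grind [I_sq])
    · exact finish ((1 + -I) * (I * (c + d)))
        (mul_mem_Zlat_I (add_mem_Zlat_I hone hnI) (mul_mem_Zlat_I hI hcd)) (by grind [I_sq])
  · obtain ⟨h0, h1⟩ := applyAff_antidiag_eq_iff.1 hfix
    obtain h | h := sq_eq_one_iff.1 hαβ
    · refine exists_isReflectingHyperplane_of_fixed
        (W := fun g => IsGrpn 4 2 2 g.1 ∧ g.2 ∈ Λ) hg hne (a := 1) (b := -α) (Or.inl one_ne_zero) fun v hv =>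
          applyAff_antidiag_eq_iff.2 ⟨?_, ?_⟩
      · linear_combination h0 - hv
      · linear_combination h1 + β * hv + (v 1 - u 1) * h
    · apply hspecial
      have ht0' : t 0 ∈ Zlat I := by
        rw [ht0]
        exact add_mem_Zlat_I (mul_mem_Zlat_I hc hI) (mul_mem_Zlat_I hd (add_mem_Zlat_I hone hI))
      have ht1' : t 1 ∈ Zlat I := by
        rw [show t 1 = -1 * (c + d * (1 + I)) by rw [ht1]; ring]
        exact mul_mem_Zlat_I hnone
          (add_mem_Zlat_I hc (mul_mem_Zlat_I hd (add_mem_Zlat_I hone hI)))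
      rcases eq_of_pow_four_eq_one hα with rfl | rfl | rfl | rfl
      · exact finish ((1 + I) * (I * (c + d)))
          (mul_mem_Zlat_I (add_mem_Zlat_I hone hI) (mul_mem_Zlat_I hI hcd)) (by grind [I_sq])
      · exact finish ((1 + -I) * (I * (c + d)))
          (mul_mem_Zlat_I (add_mem_Zlat_I hone hnI) (mul_mem_Zlat_I hI hcd)) (by grind [I_sq])
      · exact finish (t 0) ht0' (by grind [I_sq])
      · exact finish (-I * t 1) (mul_mem_Zlat_I hnI ht1') (by grind [I_sq])
end
end

section
/- Let n ≥ 2, let ω = e^{2πi/3}, and let Λ = ℤ[ω]e_1 + Σ_{j=2}^{n} ℤ[ω](1/(1−ω))(e_{j-1} − e_j) ⊆ ℂⁿ (a G(3,1,n)-invariant ℤ-lattice of full rank 2n). Then the affine reflection group W = G(3,1,n) ⋉ Λ does NOT have the Steinberg property: there exist a non-identity element g ∈ W and a point u ∈ ℂⁿ with g(u) = u such that u lies on no reflecting hyperplane of W. (For example, g(v) = diag(ω,ω,1,…,1)v + (1/(1−ω))(e_1 − e_2) is such an element.) -/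
open Matrix Complex

noncomputable section

theorem isGrpn_three_one_diagonal {n : ℕ} {d : Fin n → ℂ} (hd : ∀ i, d i ^ 3 = 1) :
    IsGrpn 3 1 n (Matrix.diagonal d) := by
  have h0 : ∀ i, d i ≠ 0 := fun i h => by simpa [h] using hd i
  refine ⟨fun i => ⟨i, by simpa using h0 i, fun j hj => ?_⟩,
    fun j => ⟨j, by simpa using h0 j, fun i hi => ?_⟩, fun i j hij => ?_, ?_⟩
  · by_contra h
    exact hj (Matrix.diagonal_apply_ne _ (Ne.symm h))
  · by_contra h
    exact hi (Matrix.diagonal_apply_ne _ h)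
  · by_cases h : i = j
    · subst h
      simpa using hd i
    · exact absurd (Matrix.diagonal_apply_ne _ h) hij
  · simp [Matrix.diagonal_apply, ← Finset.prod_pow, hd]

/-- The ring `ℤ[ω]` of Eisenstein integers, with underlying set `Zlat ω`. -/
def eisensteinSubring (ω : ℂ) (hω : ω ^ 2 + ω + 1 = 0) : Subring ℂ where
  carrier := Zlat ω
  mul_mem' := by
    rintro _ _ ⟨a, b, rfl⟩ ⟨c, d, rfl⟩
    refine ⟨a * c - b * d, a * d + b * c - b * d, ?_⟩
    push_cast
    linear_combination (b * d : ℂ) * hω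
  one_mem' := ⟨1, 0, by simp⟩
  add_mem' := by
    rintro _ _ ⟨a, b, rfl⟩ ⟨c, d, rfl⟩
    exact ⟨a + c, b + d, by push_cast; ring⟩
  zero_mem' := ⟨0, 0, by simp⟩
  neg_mem' := by
    rintro _ ⟨a, b, rfl⟩
    exact ⟨-a, -b, by push_cast; ring⟩

theorem re_im_of_sq_add_self_add_one {z : ℂ} (h : z ^ 2 + z + 1 = 0) :
    z.re = -1 / 2 ∧ z.im ^ 2 = 3 / 4 := by
  have hre := congrArg Complex.re h
  have him := congrArg Complex.im h
  simp [pow_two] at hre him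
  have h2 : z.im * (2 * z.re + 1) = 0 := by linarith
  rcases mul_eq_zero.mp h2 with h3 | h3
  · rw [h3] at hre
    nlinarith [sq_nonneg (2 * z.re + 1)]
  · have : z.re = -1 / 2 := by linarith
    refine ⟨this, ?_⟩
    rw [this] at hre
    linarith

theorem sq_add_self_add_one_of_cube {z : ℂ} (h : z ^ 3 = 1) (h1 : z ≠ 1) :
    z ^ 2 + z + 1 = 0 := by
  have : (z - 1) * (z ^ 2 + z + 1) = 0 := by linear_combination h
  exact (mul_eq_zero.mp this).resolve_left (sub_ne_zero.mpr h1)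

theorem normSq_one_sub_of_cube {z : ℂ} (h : z ^ 2 + z + 1 = 0) : normSq (1 - z) = 3 := by
  obtain ⟨hr, hi⟩ := re_im_of_sq_add_self_add_one h
  rw [normSq_apply]
  simp [hr]
  linarith

theorem normSq_ofReal_sub_mul_of_cube {z : ℂ} (h : z ^ 3 = 1) (x y : ℝ) :
    normSq (x - z * y) = (x - y) ^ 2 ∨ normSq (x - z * y) = x ^ 2 + x * y + y ^ 2 := by
  by_cases h1 : z = 1
  · left
    rw [h1, normSq_apply]
    simp
    ring
  · right
    obtain ⟨hr, hi⟩ := re_im_of_sq_add_self_add_one (sq_add_self_add_one_of_cube h h1)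
    rw [normSq_apply]
    simp [hr]
    linear_combination y ^ 2 * hi

theorem exists_int_normSq_of_mem_Zlat {ω z : ℂ} (hω : ω ^ 2 + ω + 1 = 0) (hz : z ∈ Zlat ω) :
    ∃ m : ℤ, normSq z = m := by
  obtain ⟨a, b, rfl⟩ := hz
  obtain ⟨hr, hi⟩ := re_im_of_sq_add_self_add_one hω
  refine ⟨a ^ 2 - a * b + b ^ 2, ?_⟩
  rw [normSq_apply]
  simp [hr]
  linear_combination (b : ℝ) ^ 2 * hi

/-- The sequence `1, -1, 1/4, 1/8, …`. -/
def dyadicCoord (i : ℕ) : ℝ := if i = 0 then 1 else if i = 1 then -1 else (1 / 2) ^ i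

theorem sq_dyadicCoord_ne_three_mul (i : ℕ) (m : ℤ) : dyadicCoord i ^ 2 ≠ 3 * m := by
  intro h
  obtain ⟨k, hk⟩ : ∃ k : ℕ, dyadicCoord i ^ 2 * k = 1 := by
    unfold dyadicCoord
    split_ifs
    · exact ⟨1, by norm_num⟩
    · exact ⟨1, by norm_num⟩
    · refine ⟨4 ^ i, ?_⟩
      push_cast
      rw [← pow_mul, mul_comm i 2, pow_mul, ← mul_pow]
      norm_num
  rw [h] at hk
  have : 3 * (m * k : ℤ) = 1 := by
    rw [← mul_assoc]
    exact_mod_cast hk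
  omega

theorem exists_pow_two_mul_dyadicCoord {i j : ℕ} (hi : 2 ≤ i) (hj : j < i) :
    (2 : ℝ) ^ i * dyadicCoord i = 1 ∧ ∃ e : ℤ, (2 : ℝ) ^ i * dyadicCoord j = 2 * e := by
  constructor
  · rw [dyadicCoord, if_neg (by omega), if_neg (by omega), ← mul_pow]
    norm_num
  · obtain ⟨d, rfl⟩ : ∃ d, i = j + 1 + d := ⟨i - (j + 1), by omega⟩
    unfold dyadicCoord
    split_ifs with h0 h1
    · exact ⟨2 ^ (j + d), by push_cast; ring⟩
    · exact ⟨-2 ^ (j + d), by push_cast; ring⟩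
    · refine ⟨2 ^ d, ?_⟩
      have : (2 : ℝ) ^ j * (1 / 2) ^ j = 1 := by rw [← mul_pow]; norm_num
      push_cast
      linear_combination (2 * 2 ^ d : ℝ) * this

theorem dyadicCoord_forms_ne_three_mul {i j : ℕ} (hij : j < i) (m : ℤ) :
    (dyadicCoord i - dyadicCoord j) ^ 2 ≠ 3 * m ∧
      dyadicCoord i ^ 2 + dyadicCoord i * dyadicCoord j + dyadicCoord j ^ 2 ≠ 3 * m := by
  by_cases hi : 2 ≤ i
  · obtain ⟨h1, e, he⟩ := exists_pow_two_mul_dyadicCoord hi hij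
    obtain ⟨d, rfl⟩ : ∃ d, i = d + 1 := ⟨i - 1, by omega⟩
    set x := dyadicCoord (d + 1)
    set y := dyadicCoord j
    have key : ((2 : ℝ) ^ (d + 1)) ^ 2 * (3 * m) = 2 * (2 * (2 ^ d) ^ 2 * (3 * m)) := by ring
    constructor <;> intro h <;> rw [← h] at key
    · have h2 : (1 - 2 * e : ℝ) ^ 2 = 2 * (2 * (2 ^ d) ^ 2 * (3 * m)) := by
        rw [← h, ← key, ← h1, ← he]
        ring
      have h3 : (1 - 2 * e) ^ 2 = 2 * (2 * (2 ^ d) ^ 2 * (3 * m)) := by exact_mod_cast h2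
      have h4 : 2 * (2 * (2 ^ d) ^ 2 * (3 * m) - 2 * (e ^ 2 - e)) = 1 := by
        linear_combination -h3
      omega
    · have h2 : (1 + 2 * e + (2 * e) ^ 2 : ℝ) = 2 * (2 * (2 ^ d) ^ 2 * (3 * m)) := by
        rw [← h, ← key, ← he]
        linear_combination (-1 - 2 ^ (d + 1) * x - 2 ^ (d + 1) * y) * h1
      have h3 : 1 + 2 * e + (2 * e) ^ 2 = 2 * (2 * (2 ^ d) ^ 2 * (3 * m)) := by exact_mod_cast h2
      have h4 : 2 * (2 * (2 ^ d) ^ 2 * (3 * m) - e - 2 * e ^ 2) = 1 := by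
        linear_combination -h3
      omega
  · obtain rfl : i = 1 := by omega
    obtain rfl : j = 0 := by omega
    simp only [dyadicCoord]
    norm_num
    constructor <;> intro h
    · have : 3 * m = 4 := by exact_mod_cast h.symm
      omega
    · have : 3 * m = 1 := by exact_mod_cast h.symm
      omega

theorem normSq_dyadicCoord_ne_three_mul {z : ℂ} (hz : z ^ 3 = 1) {i j : ℕ} (hij : i ≠ j)
    (m : ℤ) : normSq (dyadicCoord i - z * dyadicCoord j) ≠ 3 * m := by
  intro h
  rcases lt_or_gt_of_ne hij with hlt | hlt <;>
    obtain ⟨h1, h2⟩ := dyadicCoord_forms_ne_three_mul hlt m <;>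
    rcases normSq_ofReal_sub_mul_of_cube hz (dyadicCoord i) (dyadicCoord j) with h3 | h3
  · exact h1 (by rw [← h, h3]; ring)
  · exact h2 (by rw [← h, h3]; ring)
  · exact h1 (by rw [← h, h3])
  · exact h2 (by rw [← h, h3])

theorem sum_stdGen {n : ℕ} (j : Fin n) :
    ∑ i, stdGen n j i = if (j : ℕ) = 0 then 1 else 0 := by
  have h : ∀ i, stdGen n j i = (if i = j then (if (j : ℕ) = 0 then 1 else -1) else 0)
      + (if (i : ℕ) + 1 = (j : ℕ) then 1 else 0) := by
    intro i
    unfold stdGen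
    split_ifs with h1 h2 h3 <;> simp_all
  simp only [h, Finset.sum_add_distrib, Finset.sum_ite_eq', Finset.mem_univ, if_true]
  split_ifs with h0
  · simp [h0]
  · have : ∀ i : Fin n, ((i : ℕ) + 1 = (j : ℕ)) ↔ i = ⟨j - 1, by omega⟩ := by
      intro i
      rw [Fin.ext_iff]
      simp only
      omega
    simp [this]

theorem stdGen_mem_subring {n : ℕ} (R : Subring ℂ) (j i : Fin n) : stdGen n j i ∈ R := by
  unfold stdGen
  split_ifs
  · exact R.one_mem
  · exact R.neg_mem R.one_mem
  · exact R.one_mem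
  · exact R.zero_mem

/-- The lattice spanned over `R` by `e₁` and the `θ⁻¹ (e_{j-1} - e_j)` lies in `θ⁻¹ Rⁿ`, and
its vectors have coordinate sum in `R`. -/
theorem mem_of_eq_sum_stdGen {n : ℕ} (R : Subring ℂ) {θ : ℂ} (hθ : θ ∈ R) (hθ0 : θ ≠ 0)
    {c t : Fin n → ℂ} (hc : ∀ j, c j ∈ R)
    (ht : t = ∑ j, c j • (if (j : ℕ) = 0 then stdGen n j else (1 / θ) • stdGen n j)) :
    (∀ i, θ * t i ∈ R) ∧ ∑ i, t i ∈ R := by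
  subst ht
  constructor
  · intro i
    rw [Finset.sum_apply, Finset.mul_sum]
    refine R.sum_mem fun j _ => ?_
    split_ifs with h
    · exact R.mul_mem hθ (R.mul_mem (hc j) (stdGen_mem_subring R j i))
    · have : θ * (c j • (1 / θ) • stdGen n j) i = c j * stdGen n j i := by
        simp
        field_simp
      rw [this]
      exact R.mul_mem (hc j) (stdGen_mem_subring R j i)
  · simp only [Finset.sum_apply]
    rw [Finset.sum_comm]
    refine R.sum_mem fun j _ => ?_
    split_ifs with h
    · simp only [Pi.smul_apply, smul_eq_mul]
      rw [← Finset.mul_sum, sum_stdGen, if_pos h]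
      exact R.mul_mem (hc j) R.one_mem
    · simp only [Pi.smul_apply, smul_eq_mul]
      rw [← Finset.mul_sum, ← Finset.mul_sum, sum_stdGen, if_neg h]
      simp

/-- An affine map fixing a hyperplane pointwise has a linear part fixing its directions. -/
theorem mulVec_eq_self_of_fixes_hyperplane {n : ℕ}
    {g : Matrix (Fin n) (Fin n) ℂ × (Fin n → ℂ)} {a u w : Fin n → ℂ} {c : ℂ}
    (hg : ∀ v, ∑ i, a i * v i = c → applyAff g v = v) (hu : ∑ i, a i * u i = c)
    (hw : ∑ i, a i * w i = 0) : g.1.mulVec w = w := by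
  have h1 := hg u hu
  have h2 := hg (u + w) (by simp [mul_add, Finset.sum_add_distrib, hu, hw])
  simp only [applyAff, Matrix.mulVec_add] at h1 h2
  have : g.1.mulVec w = (g.1.mulVec u + g.1.mulVec w + g.2) - (g.1.mulVec u + g.2) := by abel
  rw [this, h2, h1]
  abel

/-- Two distinct coordinates cannot both vanish on a linear hyperplane. -/
theorem eq_of_coords_vanish_on_hyperplane {n : ℕ} {a : Fin n → ℂ} {i j : Fin n}
    (hi : ∀ w : Fin n → ℂ, ∑ k, a k * w k = 0 → w i = 0)
    (hj : ∀ w : Fin n → ℂ, ∑ k, a k * w k = 0 → w j = 0) : i = j := by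
  by_contra hij
  have h1 := hi (Pi.single i (a j) - Pi.single j (a i))
    (by simp [mul_sub, Finset.sum_sub_distrib, Pi.single_apply]; ring)
  simp [hij] at h1
  have h2 := hj (Pi.single j 1) (by simp [Pi.single_apply, h1])
  simp at h2

/-- The group `[G(3,1,n)]₂`, with lattice
`Λ = ℤ[ω]e₁ + Σ_{j=2}^n ℤ[ω](1/(1-ω))(e_{j-1} - e_j)` for `ω = e^{2πi/3}`,
fails the Steinberg property: some point fixed by a non-identity element of `W`
lies on no reflecting hyperplane of `W`. -/
theorem not_steinberg_G_3_1_n_lattice2 (n : ℕ) (hn : 2 ≤ n)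
    (ω : ℂ) (hω : ω = Complex.exp (2 * Real.pi * Complex.I / 3))
    (Λ : Set (Fin n → ℂ))
    (hΛ : Λ = {v | ∃ c : Fin n → ℂ, (∀ j, c j ∈ Zlat ω) ∧
      v = ∑ j, c j • (if (j : ℕ) = 0 then stdGen n j
        else (1 / (1 - ω)) • stdGen n j)}) :
    ∃ g, (IsGrpn 3 1 n g.1 ∧ g.2 ∈ Λ) ∧ (∃ v, applyAff g v ≠ v) ∧
      ∃ u : Fin n → ℂ, applyAff g u = u ∧
        ∀ H, IsReflectingHyperplane (fun h => IsGrpn 3 1 n h.1 ∧ h.2 ∈ Λ) H → u ∉ H := by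
  have hω3 : ω ^ 3 = 1 := by
    rw [hω, ← Complex.exp_nat_mul]
    convert Complex.exp_two_pi_mul_I using 2
    push_cast
    ring
  have hω1 : ω ≠ 1 := by
    have h := Complex.isPrimitiveRoot_exp 3 (by norm_num)
    rw [hω]
    exact_mod_cast h.ne_one (by norm_num)
  have hq := sq_add_self_add_one_of_cube hω3 hω1
  have hθ0 : 1 - ω ≠ 0 := sub_ne_zero.mpr hω1.symm
  have hNθ := normSq_one_sub_of_cube hq
  let R := eisensteinSubring ω hq
  have hωR : ω ∈ R := ⟨0, 1, by simp⟩
  have hθR : 1 - ω ∈ R := R.sub_mem R.one_mem hωR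
  let i₀ : Fin n := ⟨0, by omega⟩
  let i₁ : Fin n := ⟨1, by omega⟩
  let u : Fin n → ℂ := fun i => dyadicCoord i / (1 - ω) ^ 2
  have hu0 : u i₀ = 1 / (1 - ω) ^ 2 := by simp [u, i₀, dyadicCoord]
  have hu1 : u i₁ = -1 / (1 - ω) ^ 2 := by simp [u, i₁, dyadicCoord]
  refine ⟨(Matrix.diagonal fun i => if (i : ℕ) < 2 then ω else 1, (1 / (1 - ω)) • stdGen n i₁),
    ⟨isGrpn_three_one_diagonal fun i => ?_, ?_⟩, ⟨0, ?_⟩, u, ?_, ?_⟩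
  · split_ifs <;> simp [hω3]
  · rw [hΛ]
    refine ⟨Pi.single i₁ 1, fun j => ?_, ?_⟩
    · by_cases h : j = i₁
      · subst h
        rw [Pi.single_eq_same]
        exact R.one_mem
      · rw [Pi.single_eq_of_ne h]
        exact R.zero_mem
    · rw [Finset.sum_eq_single i₁]
      · simp [i₁]
      · intro j _ h
        simp [h]
      · simp
  · intro h
    have := congrFun h i₁
    simp [applyAff, stdGen, i₁, hθ0] at this
  · ext i
    simp only [applyAff, Pi.add_apply, Matrix.mulVec_diagonal, Pi.smul_apply, smul_eq_mul]
    by_cases h0 : i = i₀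
    · subst h0
      rw [hu0]
      simp [stdGen, i₀, i₁]
      field_simp
      ring
    by_cases h1 : i = i₁
    · subst h1
      rw [hu1]
      simp [stdGen, i₁]
      field_simp
      ring
    have h0' : (i : ℕ) ≠ 0 := fun h => h0 (Fin.ext h)
    have h1' : (i : ℕ) ≠ 1 := fun h => h1 (Fin.ext h)
    rw [if_neg (by omega)]
    simp [stdGen, h1, i₁, h0']
  · rintro H ⟨⟨a, -, c, rfl⟩, ⟨M, t⟩, ⟨⟨hrow, -, hroot, -⟩, ht⟩, ⟨v, hv⟩, hfix⟩ hu
    rw [hΛ] at ht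
    obtain ⟨b, hb, ht⟩ := ht
    obtain ⟨hΛ1, hΛ2⟩ := mem_of_eq_sum_stdGen R hθR hθ0 hb ht
    choose σ hσ hσ' using hrow
    have hM : ∀ w i, M.mulVec w i = M i (σ i) * w (σ i) := by
      intro w i
      rw [Matrix.mulVec, dotProduct, Finset.sum_eq_single (σ i)]
      · intro j _ hj
        have : M i j = 0 := by
          by_contra h
          exact hj (hσ' i j h)
        simp [this]
      · simp
    have hroot' : ∀ i, M i (σ i) ^ 3 = 1 := fun i => hroot i _ (hσ i)
    have hfixu : ∀ i, M i (σ i) * u (σ i) + t i = u i := by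
      intro i
      have := congrFun (hfix u hu) i
      rwa [applyAff, Pi.add_apply, hM] at this
    have hdir : ∀ w : Fin n → ℂ, ∑ i, a i * w i = 0 → M.mulVec w = w := fun w hw =>
      mulVec_eq_self_of_fixes_hyperplane (g := (M, t)) hfix hu hw
    have hσid : ∀ i, σ i = i := by
      intro i
      by_contra hne
      obtain ⟨m, hm⟩ := exists_int_normSq_of_mem_Zlat hq (hΛ1 i)
      refine normSq_dyadicCoord_ne_three_mul (hroot' i)
        (fun h => hne (Fin.ext h).symm : (i : ℕ) ≠ (σ i : ℕ)) m ?_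
      rw [← hm, ← hNθ, ← map_mul]
      congr 1
      have := hfixu i
      simp only [u] at this
      field_simp at this
      linear_combination -this
    simp only [hσid] at hM hroot' hfixu
    have hex : ∃ i, M i i ≠ 1 := by
      by_contra! hall
      have ht0 : t = 0 := by
        ext i
        have := hfixu i
        rw [hall i, one_mul] at this
        simpa using this
      refine hv (funext fun i => ?_)
      simp [applyAff, hM, hall, ht0]
    obtain ⟨i, hi⟩ := hex
    have hvanish : ∀ k, M k k ≠ 1 → ∀ w : Fin n → ℂ, ∑ l, a l * w l = 0 → w k = 0 := by
      intro k hk w hw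
      have h := congrFun (hdir w hw) k
      rw [hM] at h
      have : (M k k - 1) * w k = 0 := by linear_combination h
      exact (mul_eq_zero.mp this).resolve_left (sub_ne_zero.mpr hk)
    have ht0 : ∀ j, j ≠ i → t j = 0 := by
      intro j hj
      have hMj : M j j = 1 := by
        by_contra h
        exact hj (eq_of_coords_vanish_on_hyperplane (hvanish j h) (hvanish i hi))
      have := hfixu j
      rw [hMj, one_mul] at this
      simpa using this
    rw [Finset.sum_eq_single i (fun j _ hj => ht0 j hj) (by simp)] at hΛ2
    obtain ⟨m, hm⟩ := exists_int_normSq_of_mem_Zlat hq hΛ2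
    have hNi := normSq_one_sub_of_cube (sq_add_self_add_one_of_cube (hroot' i) hi)
    apply sq_dyadicCoord_ne_three_mul i m
    have h1 : (1 - M i i) * dyadicCoord i = (1 - ω) ^ 2 * t i := by
      have := hfixu i
      simp only [u] at this
      field_simp at this
      linear_combination -this
    have h2 := congrArg normSq h1
    rw [map_mul, map_mul, map_pow, hNi, hNθ, hm, normSq_ofReal] at h2
    linarith
end
end

section
/- Let r ∈ {3,4,6}, let n ≥ 3, let ξ = e^{2πi/r}, and let Λ = ℤ[ξ](ξe_1 − e_2) + Σ_{j=2}^{n} ℤ[ξ](e_{j-1} − e_j) ⊆ ℂⁿ (a G(r,r,n)-invariant ℤ-lattice of full rank 2n). Then the affine reflection group W = G(r,r,n) ⋉ Λ does NOT have the Steinberg property: there exist a non-identity element g ∈ W and a point u ∈ ℂⁿ with g(u) = u such that u lies on no reflecting hyperplane of W. -/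
open Matrix Complex

noncomputable section

/-- `ℤ[ξ]` as a subring of `ℂ`, for `ξ` a root of `X² - tX + 1`. -/
def zlatSubring (ξ : ℂ) (t : ℤ) (h : ξ ^ 2 = t * ξ - 1) : Subring ℂ where
  carrier := Zlat ξ
  zero_mem' := ⟨0, 0, by simp⟩
  one_mem' := ⟨1, 0, by simp⟩
  add_mem' := by
    rintro _ _ ⟨a, b, rfl⟩ ⟨c, d, rfl⟩
    exact ⟨a + c, b + d, by push_cast; ring⟩
  neg_mem' := by
    rintro _ ⟨a, b, rfl⟩
    exact ⟨-a, -b, by push_cast; ring⟩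
  mul_mem' := by
    rintro _ _ ⟨a, b, rfl⟩ ⟨c, d, rfl⟩
    exact ⟨a * c - b * d, a * d + b * c + t * (b * d), by
      push_cast; linear_combination ((b : ℂ) * d) * h⟩

lemma self_mem_Zlat (ξ : ℂ) : ξ ∈ Zlat ξ := ⟨0, 1, by simp⟩

/-- Comparison of coordinates in the basis `1, ξ`. -/
lemma dvd_of_div_mem_Zlat {ξ : ℂ} (hξ : ξ.im ≠ 0) {a b k : ℤ} (hk : k ≠ 0)
    (h : ((a : ℂ) + b * ξ) / k ∈ Zlat ξ) : k ∣ a ∧ k ∣ b := by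
  obtain ⟨c, d, h⟩ := h
  have hk' : (k : ℂ) ≠ 0 := by exact_mod_cast hk
  rw [div_eq_iff hk'] at h
  have him := congrArg Complex.im h
  simp [Complex.mul_im, Complex.mul_re] at him
  have hb : b = d * k := by
    have : ((b : ℝ) - d * k) * ξ.im = 0 := by linear_combination him
    have := (mul_eq_zero.1 this).resolve_right hξ
    exact_mod_cast sub_eq_zero.1 this
  have ha : a = c * k := by
    have : (a : ℂ) = c * k := by
      rw [hb] at h; push_cast at h; linear_combination h
    exact_mod_cast this
  exact ⟨⟨c, by rw [ha]; ring⟩, ⟨d, by rw [hb]; ring⟩⟩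

lemma sum_smul_genB_apply_mem {n : ℕ} {ξ : ℂ} {S : Subring ℂ} (hS : ξ ∈ S) {c : Fin n → ℂ}
    (hc : ∀ j, c j ∈ S) (i : Fin n) : (∑ j, c j • genB n ξ j) i ∈ S := by
  rw [Finset.sum_apply]
  refine S.sum_mem fun j _ => S.mul_mem (hc j) ?_
  unfold genB stdGen
  split_ifs <;> simp only [] <;> split_ifs <;>
    simp [hS, S.zero_mem, S.one_mem, S.neg_mem]

/-- A non-identity affine map with linear part in `G(r,r,n)` that fixes a hyperplane pointwise
has a non-diagonal linear part. -/
lemma exists_offDiag_of_fixes_hyperplane {r n : ℕ} (hr : 0 < r)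
    {M : Matrix (Fin n) (Fin n) ℂ} {t : Fin n → ℂ} (hM : IsGrpn r r n M)
    (hne : ∃ v, applyAff (M, t) v ≠ v) {a u : Fin n → ℂ} (ha : a ≠ 0) {c : ℂ}
    (hu : ∑ i, a i * u i = c)
    (hfix : ∀ v : Fin n → ℂ, ∑ i, a i * v i = c → applyAff (M, t) v = v) :
    ∃ p q, p ≠ q ∧ M p q ≠ 0 := by
  by_contra! hdiag
  have hfu := hfix u hu
  have hlin : ∀ w : Fin n → ℂ, ∑ i, a i * w i = 0 → M.mulVec w = w := by
    intro w hw
    have h := hfix (u + w) (by simp [mul_add, Finset.sum_add_distrib, hu, hw])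
    simp only [applyAff, Matrix.mulVec_add] at h hfu
    have := congrArg₂ (· - ·) h hfu
    rw [show M.mulVec u + M.mulVec w + t - (M.mulVec u + t) = M.mulVec w by abel] at this
    simpa using this
  have hM' : M = Matrix.diagonal fun i => M i i := by
    ext i j
    by_cases hij : i = j
    · subst hij; simp
    · rw [Matrix.diagonal_apply_ne _ hij, hdiag i j hij]
  have hkill : ∀ i j, i ≠ j → M i i ≠ 1 → a j = 0 := by
    intro i j hij hi
    have h := hlin (Pi.single i (a j) - Pi.single j (a i)) (by
      simp [mul_sub, Finset.sum_sub_distrib, Pi.single_apply, mul_comm])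
    rw [hM'] at h
    have h := congrFun h i
    simp only [Matrix.mulVec_diagonal, Pi.sub_apply, Pi.single_eq_same,
      Pi.single_eq_of_ne hij, sub_zero] at h
    have : (M i i - 1) * a j = 0 := by linear_combination h
    exact (mul_eq_zero.1 this).resolve_left (sub_ne_zero.2 hi)
  have hprod : ∏ i, M i i = 1 := by
    have h := hM.2.2.2
    rw [Nat.div_self hr, pow_one] at h
    rw [← h]
    refine Finset.prod_congr rfl fun i _ => ?_
    rw [Finset.sum_eq_single i (fun j _ hj => hdiag i j hj.symm) (by simp)]
  have hone : ∃ i, M i i ≠ 1 := by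
    by_contra! hall
    have h1 : M = 1 := by rw [hM']; simp [hall]
    obtain ⟨v, hv⟩ := hne
    simp only [applyAff, h1, Matrix.one_mulVec] at hfu hv
    exact hv (by rw [left_eq_add.1 hfu.symm, add_zero])
  obtain ⟨i, hi⟩ := hone
  obtain ⟨j, hji, hj⟩ : ∃ j, j ≠ i ∧ M j j ≠ 1 := by
    by_contra! hall
    exact hi (by rw [← hprod, Finset.prod_eq_single i (fun j _ h => hall j h) (by simp)])
  refine ha (funext fun k => ?_)
  by_cases hki : i = k
  · exact hkill j k (hki ▸ hji) hj
  · exact hkill i k hki hi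

/-- The point `(0, x, y, 1/5, 1/25, …)`. -/
def specialPoint (x y : ℂ) : ℕ → ℂ
  | 0 => 0
  | 1 => x
  | 2 => y
  | k + 3 => 1 / 5 ^ (k + 1)

/-- The sequence `d₀, d₁, d₂, 1, 1, …`. -/
def specialDiag (d₀ d₁ d₂ : ℂ) : ℕ → ℂ
  | 0 => d₀
  | 1 => d₁
  | 2 => d₂
  | _ + 3 => 1

section SpecialPoint

variable {r : ℕ} {S : Subring ℂ} {x y : ℂ}

lemma specialPoint_sub_notMem_of_lt (hroot : ∀ θ : ℂ, θ ^ r = 1 → θ ∈ S)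
    (h5 : (6 / 5 : ℂ) ∉ S) (hx : x ∉ S) (hy : y ∉ S)
    (hxy : ∀ θ : ℂ, θ ^ r = 1 → y - θ * x ∉ S) (hx6 : 6 * x ∈ S) (hy6 : 6 * y ∈ S)
    {θ : ℂ} (hθ : θ ^ r = 1) : ∀ {i j : ℕ}, j < i →
    specialPoint x y i - θ * specialPoint x y j ∉ S
  | 1, 0, _ => by simpa [specialPoint] using hx
  | 2, 0, _ => by simpa [specialPoint] using hy
  | 2, 1, _ => by simpa [specialPoint] using hxy θ hθ
  | k + 3, j, hj => by
    intro hmem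
    have hN : ∀ m : ℕ, (5 : ℂ) ^ m ∈ S := fun m => S.pow_mem (by exact_mod_cast natCast_mem S 5) m
    have h6 : (6 : ℂ) ∈ S := by exact_mod_cast natCast_mem S 6
    have key : 6 * 5 ^ k * specialPoint x y j ∈ S := by
      match j, hj with
      | 0, _ => simp [specialPoint, S.zero_mem]
      | 1, _ =>
        have := S.mul_mem (hN k) hx6
        rwa [show 6 * 5 ^ k * specialPoint x y 1 = 5 ^ k * (6 * x) by simp only [specialPoint]; ring]
      | 2, _ =>
        have := S.mul_mem (hN k) hy6
        rwa [show 6 * 5 ^ k * specialPoint x y 2 = 5 ^ k * (6 * y) by simp only [specialPoint]; ring]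
      | l + 3, hl =>
        obtain ⟨e, rfl⟩ : ∃ e, k = l + 1 + e := ⟨k - l - 1, by omega⟩
        have := S.mul_mem h6 (hN e)
        rwa [show 6 * 5 ^ (l + 1 + e) * specialPoint x y (l + 3) = 6 * 5 ^ e by
          simp only [specialPoint]; rw [pow_add]; field_simp]
    refine h5 ?_
    have := S.add_mem (S.mul_mem (S.mul_mem h6 (hN k)) hmem) (S.mul_mem (hroot θ hθ) key)
    rwa [show 6 * 5 ^ k * (specialPoint x y (k + 3) - θ * specialPoint x y j) +
      θ * (6 * 5 ^ k * specialPoint x y j) = 6 / 5 by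
        simp only [specialPoint]; rw [pow_succ]; field_simp; ring] at this

lemma specialPoint_sub_notMem (hr : 0 < r) (hroot : ∀ θ : ℂ, θ ^ r = 1 → θ ∈ S)
    (h5 : (6 / 5 : ℂ) ∉ S) (hx : x ∉ S) (hy : y ∉ S)
    (hxy : ∀ θ : ℂ, θ ^ r = 1 → y - θ * x ∉ S) (hx6 : 6 * x ∈ S) (hy6 : 6 * y ∈ S)
    {θ : ℂ} (hθ : θ ^ r = 1) {i j : ℕ} (hij : i ≠ j) :
    specialPoint x y i - θ * specialPoint x y j ∉ S := by
  rcases hij.lt_or_gt with h | h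
  · intro hmem
    have h0 : θ ≠ 0 := by rintro rfl; simp [hr.ne'] at hθ
    have hθ' : θ⁻¹ ^ r = 1 := by rw [inv_pow, hθ, inv_one]
    refine specialPoint_sub_notMem_of_lt hroot h5 hx hy hxy hx6 hy6 hθ' h ?_
    have := S.neg_mem (S.mul_mem (hroot _ hθ') hmem)
    convert this using 1
    field_simp
    ring
  · exact specialPoint_sub_notMem_of_lt hroot h5 hx hy hxy hx6 hy6 hθ h

end SpecialPoint

lemma isGrpn_diagonal {r n : ℕ} (hr : 0 < r) {d : Fin n → ℂ} (hd : ∀ i, d i ^ r = 1)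
    (hprod : ∏ i, d i = 1) : IsGrpn r r n (Matrix.diagonal d) := by
  have hd0 : ∀ i, d i ≠ 0 := by
    intro i h
    have := hd i
    simp [h, hr.ne'] at this
  have hiff : ∀ i j, Matrix.diagonal d i j ≠ 0 ↔ i = j := by
    intro i j
    by_cases h : i = j
    · subst h; simp [hd0]
    · simp [h]
  refine ⟨fun i => ⟨i, by simp [hd0], fun j hj => ((hiff i j).1 hj).symm⟩,
    fun j => ⟨j, by simp [hd0], fun i hi => (hiff i j).1 hi⟩, fun i j h => ?_, ?_⟩
  · obtain rfl := (hiff i j).1 h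
    simp [hd]
  · simp [Matrix.diagonal_apply, hprod]

/-- A sufficient criterion for the failure of the Steinberg property of `G(r,r,m+3) ⋉ Λ`,
witnessed by a diagonal element fixing `(0, x, y, 1/5, 1/25, …)`. -/
lemma not_steinberg_of_diagonal {r m : ℕ} {ξ : ℂ} (hr : 0 < r) (S : Subring ℂ)
    (hS : ∀ z, z ∈ S ↔ z ∈ Zlat ξ) (hroot : ∀ θ : ℂ, θ ^ r = 1 → θ ∈ S)
    (h5 : (6 / 5 : ℂ) ∉ S) {d₀ d₁ d₂ x y c : ℂ}
    (hd₀ : d₀ ^ r = 1) (hd₁ : d₁ ^ r = 1) (hd₂ : d₂ ^ r = 1) (hd : d₀ * (d₁ * d₂) = 1)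
    (hne : d₁ ≠ 1) (hc : c ∈ S) (hty : (1 - d₂) * y ∈ S)
    (ht : (1 - d₁) * x + (1 - d₂) * y = (ξ - 1) * c)
    (hx : x ∉ S) (hy : y ∉ S) (hxy : ∀ θ : ℂ, θ ^ r = 1 → y - θ * x ∉ S)
    (hx6 : 6 * x ∈ S) (hy6 : 6 * y ∈ S)
    (Λ : Set (Fin (m + 3) → ℂ))
    (hΛ : Λ = {v | ∃ c : Fin (m + 3) → ℂ, (∀ j, c j ∈ Zlat ξ) ∧
      v = ∑ j, c j • genB (m + 3) ξ j}) :
    ∃ g, (IsGrpn r r (m + 3) g.1 ∧ g.2 ∈ Λ) ∧ (∃ v, applyAff g v ≠ v) ∧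
      ∃ u : Fin (m + 3) → ℂ, applyAff g u = u ∧
        ∀ H, IsReflectingHyperplane (fun h => IsGrpn r r (m + 3) h.1 ∧ h.2 ∈ Λ) H → u ∉ H := by
  have hξS : ξ ∈ S := (hS ξ).2 (self_mem_Zlat ξ)
  set d : Fin (m + 3) → ℂ := fun i => specialDiag d₀ d₁ d₂ i with hd_def
  set u : Fin (m + 3) → ℂ := fun i => specialPoint x y i with hu_def
  have hfix : applyAff (Matrix.diagonal d, fun i => (1 - d i) * u i) u = u := by
    ext i
    simp only [applyAff, Pi.add_apply, Matrix.mulVec_diagonal]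
    ring
  refine ⟨(Matrix.diagonal d, fun i => (1 - d i) * u i), ⟨isGrpn_diagonal hr ?_ ?_, ?_⟩, ?_,
    u, hfix, ?_⟩
  · rintro ⟨i, hi⟩
    match i with
    | 0 => exact hd₀
    | 1 => exact hd₁
    | 2 => exact hd₂
    | k + 3 => simp [hd_def, specialDiag]
  · simp [Fin.prod_univ_succ, hd_def, specialDiag, hd]
  · rw [hΛ]
    refine ⟨fun j => match (j : ℕ) with
      | 0 => c
      | 1 => -(ξ * c)
      | 2 => -((1 - d₂) * y)
      | _ + 3 => 0, ?_, ?_⟩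
    · rintro ⟨j, hj⟩
      rw [← hS]
      match j with
      | 0 => exact hc
      | 1 => exact S.neg_mem (S.mul_mem hξS hc)
      | 2 => exact S.neg_mem hty
      | k + 3 => exact S.zero_mem
    · ext ⟨i, hi⟩
      rw [Finset.sum_apply]
      have h1 : stdGen (m + 3) 1 ⟨i, hi⟩ = if i = 1 then -1 else if i = 0 then 1 else 0 := by
        simp [stdGen, Fin.ext_iff]
      have h2 : stdGen (m + 3) 2 ⟨i, hi⟩ = if i = 2 then -1 else if i = 1 then 1 else 0 := by
        simp [stdGen, Fin.ext_iff, Nat.mod_eq_of_lt]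
      simp only [Fin.sum_univ_succ, Fin.val_succ, Fin.val_zero, zero_add, Nat.reduceAdd,
        Pi.smul_apply, smul_eq_mul, genB, hd_def, hu_def]
      match i with
      | 0 =>
        simp at h1 h2
        simp [specialPoint, specialDiag, h1, h2]
        ring
      | 1 =>
        simp at h1 h2
        simp [specialPoint, specialDiag, h1, h2]
        linear_combination ht
      | 2 => simp [specialPoint, specialDiag, h1, h2]
      | k + 3 => simp [specialPoint, specialDiag, h1, h2]
  · refine ⟨u + Pi.single 1 1, fun h => hne ?_⟩
    simp only [applyAff, Matrix.mulVec_add] at h hfix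
    have h1 := congrFun h 1
    have h2 := congrFun hfix 1
    simp only [Pi.add_apply, Matrix.mulVec_diagonal, Pi.single_eq_same] at h1 h2
    have : d 1 = 1 := by linear_combination h1 - h2
    simpa [hd_def, specialDiag] using this
  · rintro H ⟨⟨a, ha, b, rfl⟩, ⟨M, t⟩, ⟨hM, htΛ⟩, hne', hH⟩ huH
    obtain ⟨p, q, hpq, hMpq⟩ := exists_offDiag_of_fixes_hyperplane hr hM hne' ha huH hH
    have hrow : M.mulVec u p = M p q * u q := by
      refine Finset.sum_eq_single q (fun j _ hj => ?_)
        (fun h => absurd (Finset.mem_univ q) h)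
      by_contra h0
      exact hj ((hM.1 p).unique (left_ne_zero_of_mul h0) hMpq)
    have hp := congrFun (hH u huH) p
    simp only [applyAff, Pi.add_apply, hrow] at hp
    refine specialPoint_sub_notMem hr hroot h5 hx hy hxy hx6 hy6 (hM.2.2.1 p q hMpq)
      (Fin.val_ne_of_ne hpq) ?_
    rw [hΛ] at htΛ
    obtain ⟨e, he, ht'⟩ := htΛ
    simp only at ht'
    have := sum_smul_genB_apply_mem hξS (fun j => (hS _).2 (he j)) p
    rw [← ht'] at this
    convert this using 1
    change u p - M p q * u q = t p
    linear_combination -hp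

/-- The groups `[G(r,r,n)]₁`, `r ∈ {3,4,6}`, `n ≥ 3`, with lattice
`Λ = ℤ[ξ](ξe₁ - e₂) + Σ_{j=2}^n ℤ[ξ](e_{j-1} - e_j)`, fail the Steinberg property. -/
theorem not_steinberg_G_r_r_n_lattice1 (r : ℕ) (hr : r = 3 ∨ r = 4 ∨ r = 6)
    (n : ℕ) (hn : 3 ≤ n)
    (ξ : ℂ) (hξ : ξ = Complex.exp (2 * Real.pi * Complex.I / (r : ℂ)))
    (Λ : Set (Fin n → ℂ))
    (hΛ : Λ = {v | ∃ c : Fin n → ℂ, (∀ j, c j ∈ Zlat ξ) ∧ v = ∑ j, c j • genB n ξ j}) :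
    ∃ g, (IsGrpn r r n g.1 ∧ g.2 ∈ Λ) ∧ (∃ v, applyAff g v ≠ v) ∧
      ∃ u : Fin n → ℂ, applyAff g u = u ∧
        ∀ H, IsReflectingHyperplane (fun h => IsGrpn r r n h.1 ∧ h.2 ∈ Λ) H → u ∉ H := by
  obtain ⟨m, rfl⟩ : ∃ m, n = m + 3 := ⟨n - 3, by omega⟩
  have hr0 : r ≠ 0 := by omega
  have hprim : IsPrimitiveRoot ξ r := hξ ▸ Complex.isPrimitiveRoot_exp r hr0
  have him : ξ.im ≠ 0 := by
    intro h
    have hre : ξ = (ξ.re : ℂ) := Complex.ext (by simp) (by simp [h])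
    have habs : |ξ.re| = 1 := by
      have := hprim.norm'_eq_one hr0
      rwa [hre, Complex.norm_real] at this
    have hsq : ξ ^ 2 = 1 := by
      rw [hre, ← Complex.ofReal_pow, ← sq_abs, habs]; simp
    have := Nat.le_of_dvd two_pos (hprim.dvd_of_pow_eq_one 2 hsq)
    omega
  have hroot : ∀ (S : Subring ℂ), (∀ z, z ∈ S ↔ z ∈ Zlat ξ) → ∀ θ : ℂ, θ ^ r = 1 → θ ∈ S := by
    intro S hS θ hθ
    have : NeZero r := ⟨hr0⟩
    obtain ⟨k, -, rfl⟩ := hprim.eq_pow_of_pow_eq_one hθ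
    exact S.pow_mem ((hS ξ).2 (self_mem_Zlat ξ)) k
  have hnot : ∀ a b k : ℤ, k ≠ 0 → ¬ (k ∣ a ∧ k ∣ b) → ∀ z : ℂ, z = (a + b * ξ) / k →
      z ∉ Zlat ξ := by
    rintro a b k hk hkab _ rfl h
    exact hkab (dvd_of_div_mem_Zlat him hk h)
  have h5 : (6 / 5 : ℂ) ∉ Zlat ξ := hnot 6 0 5 (by norm_num) (by norm_num) _ (by norm_num)
  have h3 : (1 / 3 : ℂ) ∉ Zlat ξ := hnot 1 0 3 (by norm_num) (by norm_num) _ (by norm_num)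
  have hhalf : ∀ (S : Subring ℂ), (∀ z, z ∈ S ↔ z ∈ Zlat ξ) → ∀ x : ℂ, 2 * x ∈ S →
      ∀ θ : ℂ, θ ^ r = 1 → 1 / 3 - θ * x ∉ S := by
    intro S hS x hx θ hθ h
    have h2 := S.add_mem (S.add_mem h h) (S.mul_mem (hroot S hS θ hθ) hx)
    rw [show 1 / 3 - θ * x + (1 / 3 - θ * x) + θ * (2 * x) = 2 / 3 by ring] at h2
    exact hnot 2 0 3 (by norm_num) (by norm_num) _ (by norm_num) ((hS _).1 h2)
  have hmem : ∀ (a b : ℤ) (z : ℂ), z = a + b * ξ → z ∈ Zlat ξ := fun a b z h => ⟨a, b, h⟩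
  rcases hr with rfl | rfl | rfl
  · have hq : ξ ^ 2 = ((-1 : ℤ) : ℂ) * ξ - 1 := by
      have h1 : (ξ - 1) * (ξ ^ 2 + ξ + 1) = 0 := by linear_combination hprim.pow_eq_one
      have := (mul_eq_zero.1 h1).resolve_left (sub_ne_zero.2 (hprim.ne_one (by norm_num)))
      push_cast; linear_combination this
    have hq' : ξ ^ 2 = -ξ - 1 := by rw [hq]; push_cast; ring
    refine not_steinberg_of_diagonal (by norm_num) (zlatSubring ξ _ hq) (fun z => Iff.rfl)
      (hroot _ fun z => Iff.rfl) h5 (d₀ := ξ) (d₁ := ξ) (d₂ := ξ)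
      (x := (2 + ξ) / 3) (y := -((2 + ξ) / 3)) (c := 0)
      hprim.pow_eq_one hprim.pow_eq_one hprim.pow_eq_one
      (by linear_combination hprim.pow_eq_one) (hprim.ne_one (by norm_num))
      (Subring.zero_mem _) (hmem (-1) 0 _ ?_) (by ring)
      (hnot 2 1 3 (by norm_num) (by norm_num) _ (by norm_num))
      (hnot (-2) (-1) 3 (by norm_num) (by norm_num) _ (by push_cast; ring)) ?_
      (hmem 4 2 _ (by push_cast; ring)) (hmem (-4) (-2) _ (by push_cast; ring)) Λ hΛ
    · push_cast; linear_combination (1 / 3 : ℂ) * hq'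
    · intro θ hθ
      obtain ⟨k, hk, rfl⟩ := hprim.eq_pow_of_pow_eq_one hθ
      interval_cases k
      · exact hnot (-4) (-2) 3 (by norm_num) (by norm_num) _ (by push_cast; ring)
      · exact hnot (-1) (-2) 3 (by norm_num) (by norm_num) _
          (by push_cast; linear_combination (-1 / 3 : ℂ) * hq')
      · exact hnot (-1) 1 3 (by norm_num) (by norm_num) _
          (by push_cast; linear_combination (-(1 + ξ) / 3 : ℂ) * hq')
  · have hq : ξ ^ 2 = ((0 : ℤ) : ℂ) * ξ - 1 := by
      have h1 : (ξ ^ 2 - 1) * (ξ ^ 2 + 1) = 0 := by linear_combination hprim.pow_eq_one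
      have := (mul_eq_zero.1 h1).resolve_left
        (sub_ne_zero.2 (hprim.pow_ne_one_of_pos_of_lt (by norm_num) (by norm_num)))
      push_cast; linear_combination this
    have hq' : ξ ^ 2 = -1 := by rw [hq]; push_cast; ring
    refine not_steinberg_of_diagonal (by norm_num) (zlatSubring ξ _ hq) (fun z => Iff.rfl)
      (hroot _ fun z => Iff.rfl) h5 (d₀ := -1) (d₁ := -1) (d₂ := 1)
      (x := (1 + ξ) / 2) (y := 1 / 3) (c := -ξ)
      (by norm_num) (by norm_num) (by norm_num) (by norm_num) (by norm_num)
      (hmem 0 (-1) _ (by push_cast; ring)) (hmem 0 0 _ (by push_cast; ring))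
      (by linear_combination hq')
      (hnot 1 1 2 (by norm_num) (by norm_num) _ (by norm_num)) h3
      (hhalf _ (fun z => Iff.rfl) _ (hmem 1 1 _ (by push_cast; ring)))
      (hmem 3 3 _ (by push_cast; ring)) (hmem 2 0 _ (by norm_num)) Λ hΛ
  · have hq : ξ ^ 2 = ((1 : ℤ) : ℂ) * ξ - 1 := by
      have h1 : (ξ ^ 3 - 1) * ((ξ + 1) * (ξ ^ 2 - ξ + 1)) = 0 := by
        linear_combination hprim.pow_eq_one
      have h2 := (mul_eq_zero.1 h1).resolve_left
        (sub_ne_zero.2 (hprim.pow_ne_one_of_pos_of_lt (by norm_num) (by norm_num)))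
      have := (mul_eq_zero.1 h2).resolve_left fun h =>
        hprim.pow_ne_one_of_pos_of_lt (l := 2) (by norm_num) (by norm_num)
          (by linear_combination (ξ - 1) * h)
      push_cast; linear_combination this
    have hq' : ξ ^ 2 = ξ - 1 := by rw [hq]; push_cast; ring
    refine not_steinberg_of_diagonal (by norm_num) (zlatSubring ξ _ hq) (fun z => Iff.rfl)
      (hroot _ fun z => Iff.rfl) h5 (d₀ := -1) (d₁ := -1) (d₂ := 1)
      (x := 1 / 2) (y := 1 / 3) (c := -ξ)
      (by norm_num) (by norm_num) (by norm_num) (by norm_num) (by norm_num)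
      (hmem 0 (-1) _ (by push_cast; ring)) (hmem 0 0 _ (by push_cast; ring))
      (by linear_combination hq')
      (hnot 1 0 2 (by norm_num) (by norm_num) _ (by norm_num)) h3
      (hhalf _ (fun z => Iff.rfl) _ (hmem 1 0 _ (by norm_num)))
      (hmem 3 0 _ (by norm_num)) (hmem 2 0 _ (by norm_num)) Λ hΛ
end
end
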